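/- arXiv:2004.13302 — 2 statements merged into one kernel-verified Lean document; each statement's English description precedes it below -/
import Mathlib

section
/- Fix a threshold-weighted graph (G,θ) and a positive integer n. For every join-tree A over G, every set S ⊆ V(G), and every relation 𝒜 ⊆ [n]^{A|S}, one has μ(𝒜) ≤ (1/n)^{Φ_θ(A|S)} · χ_{A|S}(𝒜). -/
open scoped Classical

noncomputable section

namespace Paper

/-- A join-tree: a finite rooted binary tree whose leaves are labeled by
edges (elements of `Sym2 α`) or by `⊥` (here `none`). -/
inductive JoinTree (α : Type*) where
  | leaf : Option (Sym2 α) → JoinTree α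
  | node : JoinTree α → JoinTree α → JoinTree α

variable {V : Type*}

/-- The vertex set of a finite edge set (a finite subgraph given by its edges). -/
def vset (F : Finset (Sym2 V)) : Set V := {v | ∃ e ∈ F, v ∈ e}

lemma vset_mono {F F' : Finset (Sym2 V)} (h : F ⊆ F') : vset F ⊆ vset F' := by
  rintro v ⟨e, he, hv⟩
  exact ⟨e, h he, hv⟩

/-- `Δ_θ(F) = |V(F)| − Σ_{e ∈ E(F)} θ(e)`. -/
def Delta (θ : Sym2 V → ℝ) (F : Finset (Sym2 V)) : ℝ :=
  ((vset F).ncard : ℝ) - ∑ e ∈ F, θ e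

/-- `θ` is a threshold weighting on the graph with edge set `E`:
it takes values in `[0,2]` on `E`, `Δ_θ(F) ≥ 0` for every finite subgraph `F ⊆ E`,
and `Δ_θ(E) = 0` whenever `E` is finite. -/
def IsThresholdWeighting (E : Set (Sym2 V)) (θ : Sym2 V → ℝ) : Prop :=
  (∀ e ∈ E, 0 ≤ θ e ∧ θ e ≤ 2) ∧
  (∀ F : Finset (Sym2 V), (F : Set (Sym2 V)) ⊆ E → 0 ≤ Delta θ F) ∧
  (∀ hE : E.Finite, Delta θ hE.toFinset = 0)

/-- `F ⊖ S`: the union of the connected components of `F` that are vertex-disjoint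
from `S`. -/
def elimS (F : Finset (Sym2 V)) (S : Set V) : Finset (Sym2 V) :=
  F.filter fun e =>
    ∀ v ∈ e, ∀ s ∈ S, ¬ (SimpleGraph.fromEdgeSet (F : Set (Sym2 V))).Reachable v s

/-- The graph with edge set `F` is connected. -/
def ConnE (F : Finset (Sym2 V)) : Prop :=
  ∀ u ∈ vset F, ∀ w ∈ vset F, (SimpleGraph.fromEdgeSet (F : Set (Sym2 V))).Reachable u w

/-- The subgraph of `F` induced on a vertex set `T`. -/
def induced (F : Finset (Sym2 V)) (T : Set V) : Finset (Sym2 V) :=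
  F.filter fun e => ∀ v ∈ e, v ∈ T

namespace JoinTree

/-- The graph of a join-tree: the finite subgraph whose edges are the labels
occurring in the tree. -/
def graph : JoinTree V → Finset (Sym2 V)
  | leaf none => ∅
  | leaf (some e) => {e}
  | node B C => graph B ∪ graph C

/-- `Sub D A` means `D ⪯ A`: `D = ⟨⟩`, or `D = A`, or `D` is a sub-join-tree of a
child of `A`. -/
inductive Sub : JoinTree V → JoinTree V → Prop
  | empty (A : JoinTree V) : Sub (leaf none) A
  | refl (A : JoinTree V) : Sub A A
  | left {D B C : JoinTree V} : Sub D B → Sub D (node B C)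
  | right {D B C : JoinTree V} : Sub D C → Sub D (node B C)

/-- `SubP D A` means `D ≺ A`, i.e. `D ⪯ A` and `D ≠ A`. -/
def SubP (D A : JoinTree V) : Prop := Sub D A ∧ D ≠ A

/-- A join-tree is atomic if it is a single (labeled or unlabeled) leaf. -/
def Atomic (A : JoinTree V) : Prop := ∃ l, A = leaf l

/-- Replace every leaf label not belonging to `E'` by `⊥`. -/
def prune : JoinTree V → Finset (Sym2 V) → JoinTree V
  | leaf none, _ => leaf none
  | leaf (some e), E' => if e ∈ E' then leaf (some e) else leaf none
  | node B C, E' => node (prune B E') (prune C E')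

/-- `A ⊖ S`: delete all leaf labels except those belonging to `Gr(A) ⊖ S`. -/
def elimT (A : JoinTree V) (S : Set V) : JoinTree V := prune A (Paper.elimS A.graph S)

/-- `A` is a join-tree over the graph with edge set `E` (all labels come from `E`). -/
def Over (E : Set (Sym2 V)) (A : JoinTree V) : Prop := (A.graph : Set (Sym2 V)) ⊆ E

lemma graph_mono_of_sub {D A : JoinTree V} (h : Sub D A) : D.graph ⊆ A.graph := by
  induction h with
  | empty A => intro e he; simp [graph] at he
  | refl A => exact Finset.Subset.refl _
  | left _ ih => exact ih.trans Finset.subset_union_left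
  | right _ ih => exact ih.trans Finset.subset_union_right

end JoinTree

open JoinTree

/-- The constraints defining the two-parameter potential function `Φ_θ(A|S)`:
nonnegativity, the atomic base case, inequalities (†) and (inverted †) (in both
orders of the children) and inequality (‡). -/
def Phi2Ok (E : Set (Sym2 V)) (θ : Sym2 V → ℝ) (g : JoinTree V → Set V → ℝ) : Prop :=
  (∀ (A : JoinTree V) (S : Set V), Over E A → 0 ≤ g A S) ∧
  (∀ (A : JoinTree V) (S : Set V), Over E A → Atomic A →
      Delta θ (elimS A.graph S) ≤ g A S) ∧
  (∀ (B C : JoinTree V) (S : Set V), Over E (JoinTree.node B C) →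
      g B S + Delta θ (elimS C.graph (S ∪ vset B.graph)) ≤ g (JoinTree.node B C) S) ∧
  (∀ (B C : JoinTree V) (S : Set V), Over E (JoinTree.node B C) →
      g C S + Delta θ (elimS B.graph (S ∪ vset C.graph)) ≤ g (JoinTree.node B C) S) ∧
  (∀ (B C : JoinTree V) (S : Set V), Over E (JoinTree.node B C) →
      Delta θ (elimS B.graph S) + g C (S ∪ vset B.graph) ≤ g (JoinTree.node B C) S) ∧
  (∀ (B C : JoinTree V) (S : Set V), Over E (JoinTree.node B C) →
      Delta θ (elimS C.graph S) + g B (S ∪ vset C.graph) ≤ g (JoinTree.node B C) S) ∧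
  (∀ (A D : JoinTree V) (S : Set V), Over E A → SubP D A → ¬ (vset D.graph ⊆ S) →
      (g D S + g A (S ∪ vset D.graph) + Delta θ (elimS A.graph S)) / 2 ≤ g A S)

/-- The two-parameter potential function `Φ_θ(A|S)`: the pointwise smallest
function satisfying the constraints `Phi2Ok`. -/
def Phi2 (E : Set (Sym2 V)) (θ : Sym2 V → ℝ) (A : JoinTree V) (S : Set V) : ℝ :=
  sInf { y | ∃ g : JoinTree V → Set V → ℝ, Phi2Ok E θ g ∧ y = g A S }

/-- The coordinate set of the relation space `[n]^{F|S}`, namely `V(F) ∖ S`. -/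
def coords (F : Finset (Sym2 V)) (S : Set V) : Set V := vset F \ S

lemma coords_mono {F F' : Finset (Sym2 V)} (h : F ⊆ F') (S : Set V) :
    coords F S ⊆ coords F' S := fun v hv => ⟨vset_mono h hv.1, hv.2⟩

lemma coords_anti (F : Finset (Sym2 V)) {S T : Set V} (hST : S ⊆ T) :
    coords F T ⊆ coords F S := fun v hv => ⟨hv.1, fun h => hv.2 (hST h)⟩

/-- Tuples `[n]^U`. -/
def Tup (n : ℕ) (U : Set V) : Type _ := U → Fin n

/-- The density `μ(𝒜) = |𝒜| / n^{|U|}` of a relation `𝒜 ⊆ [n]^U`. -/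
def mu (n : ℕ) {U : Set V} (R : Set (Tup n U)) : ℝ :=
  (R.ncard : ℝ) / (n : ℝ) ^ U.ncard

/-- Projection of a tuple to a subset of the coordinates. -/
def projMap (n : ℕ) {U U' : Set V} (h : U' ⊆ U) (x : Tup n U) : Tup n U' :=
  fun v => x ⟨v.1, h v.2⟩

/-- Projection of a relation to a subset of the coordinates. -/
def projSet (n : ℕ) {U U' : Set V} (h : U' ⊆ U) (R : Set (Tup n U)) : Set (Tup n U') :=
  projMap n h '' R

/-- The restriction `𝒜 ↾ z ⊆ [n]^{V(F) ∖ T}` of a relation `𝒜 ⊆ [n]^{F|S}`,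
for `T ⊇ S` and an assignment `z`: those `x` such that some `y ∈ 𝒜` agrees with
`x` on `V(F) ∖ T` and agrees with `z` on `V(F) ∩ T`. -/
def restrictRel (n : ℕ) (F : Finset (Sym2 V)) {S T : Set V} (hST : S ⊆ T)
    (z : V → Fin n) (R : Set (Tup n (coords F S))) : Set (Tup n (coords F T)) :=
  { x | ∃ y ∈ R, (∀ v : coords F T, y ⟨v.1, coords_anti F hST v.2⟩ = x v) ∧
        (∀ v : coords F S, v.1 ∈ T → y v = z v.1) }

/-- `𝒜` is an `F|S`-pathset: every restriction has density at most
`(1/n)^{Δ_θ(F ⊖ T)}`. -/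
def IsPathset (n : ℕ) (θ : Sym2 V → ℝ) (F : Finset (Sym2 V)) (S : Set V)
    (R : Set (Tup n (coords F S))) : Prop :=
  ∀ (T : Set V) (hST : S ⊆ T) (z : V → Fin n),
    mu n (restrictRel n F hST z R) ≤ ((1 : ℝ) / n) ^ (Delta θ (elimS F T))

/-- Pathset complexity `χ_{A|S}(𝒜)`. -/
def pchi (n : ℕ) (θ : Sym2 V → ℝ) (S : Set V) :
    (A : JoinTree V) → Set (Tup n (coords A.graph S)) → ℕ
  | JoinTree.leaf l, R =>
      sInf { m | ∃ f : Fin m → Set (Tup n (coords (JoinTree.leaf l : JoinTree V).graph S)),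
        (∀ i, IsPathset n θ (JoinTree.leaf l : JoinTree V).graph S (f i)) ∧ R ⊆ ⋃ i, f i }
  | JoinTree.node B C, R =>
      sInf { t | ∃ (m : ℕ)
        (As : Fin m → Set (Tup n (coords (JoinTree.node B C).graph S)))
        (Bs : Fin m → Set (Tup n (coords B.graph S)))
        (Cs : Fin m → Set (Tup n (coords C.graph S))),
        (∀ i, IsPathset n θ (JoinTree.node B C).graph S (As i)) ∧
        (∀ i, IsPathset n θ B.graph S (Bs i)) ∧
        (∀ i, IsPathset n θ C.graph S (Cs i)) ∧
        (∀ i, ∀ x ∈ As i,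
          projMap n (coords_mono
            (JoinTree.graph_mono_of_sub (JoinTree.Sub.left (JoinTree.Sub.refl B))) S) x ∈ Bs i ∧
          projMap n (coords_mono
            (JoinTree.graph_mono_of_sub (JoinTree.Sub.right (JoinTree.Sub.refl C))) S) x ∈ Cs i) ∧
        (R ⊆ ⋃ i, As i) ∧
        t = ∑ i, max (pchi n θ S B (Bs i)) (pchi n θ S C (Cs i)) }

lemma finite_vset (F : Finset (Sym2 V)) : (vset F).Finite := by
  have h : vset F = ⋃ e ∈ F, {v | v ∈ e} := by ext v; simp [vset]
  rw [h]
  refine F.finite_toSet.biUnion fun e _ => ?_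
  induction e using Sym2.ind with
  | _ a b => exact (Set.toFinite {a, b}).subset fun v hv => by simpa using hv

lemma finite_coords (F : Finset (Sym2 V)) (S : Set V) : (coords F S).Finite :=
  (finite_vset F).subset Set.sdiff_subset

lemma finite_tup (n : ℕ) {U : Set V} (hU : U.Finite) : Finite (Tup n U) :=
  have := hU.to_subtype
  inferInstanceAs (Finite (U → Fin n))

lemma card_tup (n : ℕ) {U : Set V} (hU : U.Finite) : Nat.card (Tup n U) = n ^ U.ncard := by
  have := hU.to_subtype
  change Nat.card (U → Fin n) = _
  rw [Nat.card_fun, Nat.card_fin, Nat.card_coe_set_eq]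

lemma mu_nonneg {n : ℕ} {U : Set V} (R : Set (Tup n U)) : 0 ≤ mu n R := by
  unfold mu; positivity

lemma mu_mono {n : ℕ} {U : Set V} (hU : U.Finite) {R R' : Set (Tup n U)} (h : R ⊆ R') :
    mu n R ≤ mu n R' := by
  have := finite_tup n hU
  unfold mu
  gcongr
  exact Set.toFinite _

lemma mu_univ {n : ℕ} (hn : 0 < n) {U : Set V} (hU : U.Finite) :
    mu n (Set.univ : Set (Tup n U)) = 1 := by
  unfold mu
  rw [Set.ncard_univ, card_tup n hU]
  push_cast
  exact div_self (by positivity)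

lemma mu_le_one {n : ℕ} (hn : 0 < n) {U : Set V} (hU : U.Finite) (R : Set (Tup n U)) :
    mu n R ≤ 1 :=
  (mu_mono hU (Set.subset_univ R)).trans_eq (mu_univ hn hU)

lemma mu_le_sum {n : ℕ} {U : Set V} (hU : U.Finite) {ι : Type*} [Fintype ι]
    {R : Set (Tup n U)} {f : ι → Set (Tup n U)} (h : R ⊆ ⋃ i, f i) :
    mu n R ≤ ∑ i, mu n (f i) := by
  have := finite_tup n hU
  refine (mu_mono hU h).trans ?_
  unfold mu
  rw [← Finset.sum_div]
  gcongr
  have h1 := Set.ncard_iUnion_le_of_fintype f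
  exact_mod_cast h1

lemma mu_le_mul_of_fibers {n : ℕ} (hn : 0 < n) {U U' W : Set V} (hU : U.Finite)
    (h₁ : U' ⊆ U) (h₂ : W ⊆ U) (hdisj : Disjoint U' W) (hcov : U ⊆ U' ∪ W)
    {R : Set (Tup n U)} {P : Set (Tup n U')} {Q : Tup n U' → Set (Tup n W)} {c : ℝ}
    (hP : ∀ x ∈ R, projMap n h₁ x ∈ P)
    (hQ : ∀ x ∈ R, projMap n h₂ x ∈ Q (projMap n h₁ x))
    (hc : ∀ p ∈ P, mu n (Q p) ≤ c) : mu n R ≤ mu n P * c := by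
  have hU' := hU.subset h₁
  have hW := hU.subset h₂
  have := finite_tup n hU
  have := finite_tup n hU'
  have := finite_tup n hW
  have := Fintype.ofFinite (Tup n U')
  have hcard : U.ncard = U'.ncard + W.ncard := by
    rw [← Set.ncard_union_eq hdisj hU' hW, Set.Subset.antisymm hcov (Set.union_subset h₁ h₂)]
  have hcount : (R.ncard : ℝ) ≤ ∑ p ∈ P.toFinset, ((Q p).ncard : ℝ) := by
    have hinj : Set.InjOn (fun x : Tup n U => (⟨projMap n h₁ x, projMap n h₂ x⟩ :
        Tup n U' × Tup n W)) R := by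
      intro x _ y _ hxy
      simp only [Prod.mk.injEq] at hxy
      funext v
      rcases hcov v.2 with hv | hv
      · exact congrFun hxy.1 ⟨v.1, hv⟩
      · exact congrFun hxy.2 ⟨v.1, hv⟩
    have hsub : (fun x : Tup n U => (⟨projMap n h₁ x, projMap n h₂ x⟩ :
        Tup n U' × Tup n W)) '' R ⊆ ⋃ p ∈ P.toFinset, (fun w => (p, w)) '' Q p := by
      rintro _ ⟨x, hx, rfl⟩
      simp only [Set.mem_iUnion]
      exact ⟨projMap n h₁ x, by simpa using hP x hx, _, hQ x hx, rfl⟩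
    have h3 : R.ncard ≤ ∑ p ∈ P.toFinset, (Q p).ncard := by
      rw [← hinj.ncard_image]
      refine (Set.ncard_le_ncard hsub (Set.toFinite _)).trans ?_
      refine (Finset.set_ncard_biUnion_le _ _).trans (Finset.sum_le_sum fun p _ => ?_)
      exact Set.ncard_image_le (Set.toFinite _)
    exact_mod_cast h3
  have hn' : (0 : ℝ) < n := by exact_mod_cast hn
  have hfib : ∀ p ∈ P.toFinset, ((Q p).ncard : ℝ) ≤ c * (n : ℝ) ^ W.ncard := by
    intro p hp
    have := hc p (by simpa using hp)
    unfold mu at this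
    rwa [div_le_iff₀ (by positivity)] at this
  have hle := hcount.trans (Finset.sum_le_sum hfib)
  rw [Finset.sum_const, nsmul_eq_mul, ← Set.ncard_eq_toFinset_card'] at hle
  unfold mu
  rw [hcard, div_le_iff₀ (by positivity), pow_add]
  refine hle.trans_eq ?_
  field_simp

/-- Extension of a tuple to an assignment of all vertices, by a default value. -/
def extendTup {n : ℕ} (hn : 0 < n) {U : Set V} (p : Tup n U) (v : V) : Fin n :=
  if h : v ∈ U then p ⟨v, h⟩ else ⟨0, hn⟩

lemma mu_join_le {n : ℕ} (hn : 0 < n) {F F₁ F₂ : Finset (Sym2 V)} {S : Set V}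
    (h₁ : F₁ ⊆ F) (h₂ : F₂ ⊆ F) (hcov : F ⊆ F₁ ∪ F₂)
    {R : Set (Tup n (coords F S))} {P : Set (Tup n (coords F₁ S))}
    {Q : Set (Tup n (coords F₂ S))} {c : ℝ}
    (hP : ∀ x ∈ R, projMap n (coords_mono h₁ S) x ∈ P)
    (hQ : ∀ x ∈ R, projMap n (coords_mono h₂ S) x ∈ Q)
    (hc : ∀ z, mu n (restrictRel n F₂ (T := S ∪ vset F₁) Set.subset_union_left z Q) ≤ c) :
    mu n R ≤ mu n P * c := by
  refine mu_le_mul_of_fibers hn (finite_coords F S) (coords_mono h₁ S)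
    ((coords_anti F₂ Set.subset_union_left).trans (coords_mono h₂ S)) ?_ ?_
    (Q := fun p => restrictRel n F₂ (T := S ∪ vset F₁) Set.subset_union_left
      (extendTup hn p) Q) hP ?_ fun p _ => hc _
  · rw [Set.disjoint_left]
    exact fun v hv hv' => hv'.2 (Or.inr hv.1)
  · rintro v ⟨⟨e, he, hve⟩, hvS⟩
    by_cases hv : v ∈ vset F₁
    · exact Or.inl ⟨hv, hvS⟩
    · rcases Finset.mem_union.1 (hcov he) with h | h
      · exact absurd ⟨e, h, hve⟩ hv
      · exact Or.inr ⟨⟨e, h, hve⟩, fun h => h.elim hvS hv⟩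
  · intro x hx
    refine ⟨_, hQ x hx, fun v => rfl, fun v hv => ?_⟩
    have hv₁ : v.1 ∈ coords F₁ S := ⟨hv.resolve_left v.2.2, v.2.2⟩
    simp [extendTup, hv₁, projMap]

lemma restrictRel_self {n : ℕ} (F : Finset (Sym2 V)) (S : Set V) (z : V → Fin n)
    (R : Set (Tup n (coords F S))) : restrictRel n F (Set.Subset.refl S) z R = R := by
  ext x
  constructor
  · rintro ⟨y, hy, hyx, -⟩
    rwa [show x = y from funext fun v => (hyx v).symm]
  · exact fun hx => ⟨x, hx, fun v => rfl, fun v hv => absurd hv v.2.2⟩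

lemma restrictRel_restrictRel {n : ℕ} (F : Finset (Sym2 V)) {S T T' : Set V} (hST : S ⊆ T)
    (hTT' : T ⊆ T') (z z' : V → Fin n) (R : Set (Tup n (coords F S))) :
    restrictRel n F hTT' z' (restrictRel n F hST z R) ⊆
      restrictRel n F (hST.trans hTT') (fun v => if v ∈ T then z v else z' v) R := by
  rintro x ⟨y, ⟨w, hw, hwy, hwz⟩, hyx, hyz⟩
  refine ⟨w, hw, fun v => (hwy ⟨v.1, coords_anti F hTT' v.2⟩).trans (hyx v), fun v hv => ?_⟩
  by_cases hvT : v.1 ∈ T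
  · simpa [hvT] using hwz v hvT
  · have hv' : v.1 ∈ coords F T := ⟨v.2.1, hvT⟩
    simpa [hvT] using (hwy ⟨v.1, hv'⟩).trans (hyz ⟨v.1, hv'⟩ hv)

lemma IsPathset.mu_le {n : ℕ} (hn : 0 < n) {θ : Sym2 V → ℝ} {F : Finset (Sym2 V)} {S : Set V}
    {R : Set (Tup n (coords F S))} (h : IsPathset n θ F S R) :
    mu n R ≤ ((1 : ℝ) / n) ^ Delta θ (elimS F S) := by
  have := h S (Set.Subset.refl S) fun _ => ⟨0, hn⟩
  rwa [restrictRel_self] at this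

lemma IsPathset.restrictRel {n : ℕ} {θ : Sym2 V → ℝ} {F : Finset (Sym2 V)} {S T : Set V}
    {R : Set (Tup n (coords F S))} (h : IsPathset n θ F S R) (hST : S ⊆ T) (z : V → Fin n) :
    IsPathset n θ F T (restrictRel n F hST z R) := fun T' hTT' z' =>
  (mu_mono (finite_coords F T') (restrictRel_restrictRel F hST hTT' z z' R)).trans
    (h T' (hST.trans hTT') _)

lemma vset_elimS_subset (F : Finset (Sym2 V)) (T : Set V) : vset (elimS F T) ⊆ coords F T := by
  rintro v ⟨e, he, hv⟩
  rw [elimS, Finset.mem_filter] at he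
  exact ⟨⟨e, he.1, hv⟩, fun hvT => he.2 v hv v hvT (SimpleGraph.Reachable.refl v)⟩

lemma isPathset_singleton {n : ℕ} (hn : 0 < n) {θ : Sym2 V → ℝ} {F : Finset (Sym2 V)}
    (hF : ∀ e ∈ F, 0 ≤ θ e) {S : Set V} (x : Tup n (coords F S)) :
    IsPathset n θ F S {x} := by
  intro T hST z
  have := finite_tup n (finite_coords F T)
  have hn₁ : (1 : ℝ) ≤ n := by exact_mod_cast hn
  have hcard : (restrictRel n F hST z {x}).ncard ≤ 1 := by
    rw [Set.ncard_le_one]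
    rintro y ⟨_, rfl, hy, -⟩ y' ⟨_, rfl, hy', -⟩
    exact funext fun v => (hy v).symm.trans (hy' v)
  have hexp : Delta θ (elimS F T) ≤ ((coords F T).ncard : ℝ) := by
    have h₁ : ((vset (elimS F T)).ncard : ℝ) ≤ (coords F T).ncard := by
      exact_mod_cast Set.ncard_le_ncard (vset_elimS_subset F T) (finite_coords F T)
    have h₂ : 0 ≤ ∑ e ∈ elimS F T, θ e :=
      Finset.sum_nonneg fun e he => hF e (Finset.mem_filter.1 he).1
    unfold Delta
    linarith
  calc mu n (restrictRel n F hST z {x}) ≤ 1 / (n : ℝ) ^ (coords F T).ncard := by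
        unfold mu
        gcongr
        exact_mod_cast hcard
    _ = ((1 : ℝ) / n) ^ ((coords F T).ncard : ℝ) := by rw [Real.rpow_natCast, one_div_pow]
    _ ≤ _ := Real.rpow_le_rpow_of_exponent_ge (by positivity)
        (by rw [div_le_one (by positivity)]; exact hn₁) hexp

lemma exists_pchi_leaf {n : ℕ} (hn : 0 < n) {θ : Sym2 V → ℝ} {S : Set V} {l : Option (Sym2 V)}
    (hA : ∀ e ∈ (leaf l).graph, 0 ≤ θ e) (R : Set (Tup n (coords (leaf l).graph S))) :
    ∃ f : Fin (pchi n θ S (leaf l) R) → Set (Tup n (coords (leaf l).graph S)),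
      (∀ i, IsPathset n θ (leaf l).graph S (f i)) ∧ R ⊆ ⋃ i, f i := by
  rw [pchi]
  have := finite_tup n (finite_coords (leaf l).graph S)
  refine Nat.sInf_mem (s := {m | ∃ f : Fin m → Set (Tup n (coords (leaf l).graph S)),
      (∀ i, IsPathset n θ (leaf l).graph S (f i)) ∧ R ⊆ ⋃ i, f i})
    ⟨_, fun i => {(Finite.equivFin _).symm i}, fun i => isPathset_singleton hn hA _, fun x _ => ?_⟩
  exact Set.mem_iUnion.2 ⟨Finite.equivFin _ x, by simp⟩

/-- A triple of relations which may occur as a single term of a family witnessing the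
pathset complexity of a join. -/
structure IsPathsetJoin (n : ℕ) (θ : Sym2 V → ℝ) (S : Set V) (B C : JoinTree V)
    (A' : Set (Tup n (coords (node B C).graph S))) (B' : Set (Tup n (coords B.graph S)))
    (C' : Set (Tup n (coords C.graph S))) : Prop where
  pathset : IsPathset n θ (node B C).graph S A'
  pathset_left : IsPathset n θ B.graph S B'
  pathset_right : IsPathset n θ C.graph S C'
  proj_left : ∀ x ∈ A',
    projMap n (coords_mono (graph_mono_of_sub (Sub.left (Sub.refl B))) S) x ∈ B'
  proj_right : ∀ x ∈ A',
    projMap n (coords_mono (graph_mono_of_sub (Sub.right (Sub.refl C))) S) x ∈ C'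

lemma exists_pchi_node {n : ℕ} (hn : 0 < n) {θ : Sym2 V → ℝ} {S : Set V} {B C : JoinTree V}
    (hA : ∀ e ∈ (node B C).graph, 0 ≤ θ e) (R : Set (Tup n (coords (node B C).graph S))) :
    ∃ (m : ℕ) (As : Fin m → Set (Tup n (coords (node B C).graph S)))
      (Bs : Fin m → Set (Tup n (coords B.graph S)))
      (Cs : Fin m → Set (Tup n (coords C.graph S))),
      (∀ i, IsPathsetJoin n θ S B C (As i) (Bs i) (Cs i)) ∧ (R ⊆ ⋃ i, As i) ∧
      pchi n θ S (node B C) R = ∑ i, max (pchi n θ S B (Bs i)) (pchi n θ S C (Cs i)) := by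
  have := finite_tup n (finite_coords (node B C).graph S)
  have hB := graph_mono_of_sub (Sub.left (C := C) (Sub.refl B))
  have hC := graph_mono_of_sub (Sub.right (B := B) (Sub.refl C))
  rw [pchi]
  obtain ⟨m, As, Bs, Cs, h₁, h₂, h₃, h₄, h₅, h₆⟩ := Nat.sInf_mem (s := { t | ∃ (m : ℕ)
        (As : Fin m → Set (Tup n (coords (JoinTree.node B C).graph S)))
        (Bs : Fin m → Set (Tup n (coords B.graph S)))
        (Cs : Fin m → Set (Tup n (coords C.graph S))),
        (∀ i, IsPathset n θ (JoinTree.node B C).graph S (As i)) ∧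
        (∀ i, IsPathset n θ B.graph S (Bs i)) ∧
        (∀ i, IsPathset n θ C.graph S (Cs i)) ∧
        (∀ i, ∀ x ∈ As i,
          projMap n (coords_mono hB S) x ∈ Bs i ∧ projMap n (coords_mono hC S) x ∈ Cs i) ∧
        (R ⊆ ⋃ i, As i) ∧
        t = ∑ i, max (pchi n θ S B (Bs i)) (pchi n θ S C (Cs i)) })
    ⟨_, _, fun i => {(Finite.equivFin _).symm i},
      fun i => {projMap n (coords_mono hB S) ((Finite.equivFin _).symm i)},
      fun i => {projMap n (coords_mono hC S) ((Finite.equivFin _).symm i)},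
      fun i => isPathset_singleton hn hA _,
      fun i => isPathset_singleton hn (fun e he => hA e (hB he)) _,
      fun i => isPathset_singleton hn (fun e he => hA e (hC he)) _,
      by rintro i x rfl; exact ⟨rfl, rfl⟩,
      fun x _ => Set.mem_iUnion.2 ⟨Finite.equivFin _ x, by simp⟩, rfl⟩
  exact ⟨m, As, Bs, Cs, fun i => ⟨h₁ i, h₂ i, h₃ i, fun x hx => (h₄ i x hx).1,
    fun x hx => (h₄ i x hx).2⟩, h₅, h₆⟩

lemma pchi_leaf_le {n : ℕ} {θ : Sym2 V → ℝ} {S : Set V} {l : Option (Sym2 V)}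
    {R : Set (Tup n (coords (leaf l).graph S))} {m : ℕ}
    (f : Fin m → Set (Tup n (coords (leaf l).graph S)))
    (hf : ∀ i, IsPathset n θ (leaf l).graph S (f i)) (hR : R ⊆ ⋃ i, f i) :
    pchi n θ S (leaf l) R ≤ m := by
  rw [pchi]
  exact Nat.sInf_le ⟨f, hf, hR⟩

lemma pchi_node_le {n : ℕ} {θ : Sym2 V → ℝ} {S : Set V} {B C : JoinTree V}
    {R : Set (Tup n (coords (node B C).graph S))} {m : ℕ}
    {As : Fin m → Set (Tup n (coords (node B C).graph S))}
    {Bs : Fin m → Set (Tup n (coords B.graph S))}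
    {Cs : Fin m → Set (Tup n (coords C.graph S))}
    (h : ∀ i, IsPathsetJoin n θ S B C (As i) (Bs i) (Cs i)) (hR : R ⊆ ⋃ i, As i) :
    pchi n θ S (node B C) R ≤ ∑ i, max (pchi n θ S B (Bs i)) (pchi n θ S C (Cs i)) := by
  rw [pchi]
  exact Nat.sInf_le ⟨m, As, Bs, Cs, fun i => (h i).pathset, fun i => (h i).pathset_left,
    fun i => (h i).pathset_right,
    fun i x hx => ⟨(h i).proj_left x hx, (h i).proj_right x hx⟩, hR, rfl⟩

lemma IsPathsetJoin.pchi_le {n : ℕ} {θ : Sym2 V → ℝ} {S : Set V} {B C : JoinTree V}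
    {A' : Set (Tup n (coords (node B C).graph S))} {B' : Set (Tup n (coords B.graph S))}
    {C' : Set (Tup n (coords C.graph S))} (h : IsPathsetJoin n θ S B C A' B' C') :
    pchi n θ S (node B C) A' ≤ max (pchi n θ S B B') (pchi n θ S C C') := by
  have := pchi_node_le (m := 1) (fun _ => h) (Set.subset_iUnion (fun _ : Fin 1 => A') 0)
  simpa using this

lemma projMap_mem_restrictRel {n : ℕ} {F F' : Finset (Sym2 V)} (hF : F' ⊆ F) {S T : Set V}
    (hST : S ⊆ T) {z : V → Fin n} {R : Set (Tup n (coords F S))}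
    {R' : Set (Tup n (coords F' S))} (h : ∀ x ∈ R, projMap n (coords_mono hF S) x ∈ R')
    {x : Tup n (coords F T)} (hx : x ∈ restrictRel n F hST z R) :
    projMap n (coords_mono hF T) x ∈ restrictRel n F' hST z R' := by
  obtain ⟨y, hy, hyx, hyz⟩ := hx
  exact ⟨_, h y hy, fun v => hyx ⟨v.1, coords_mono hF T v.2⟩,
    fun v hv => hyz ⟨v.1, coords_mono hF S v.2⟩ hv⟩

lemma restrictRel_subset_iUnion {n : ℕ} {F : Finset (Sym2 V)} {S T : Set V} (hST : S ⊆ T)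
    (z : V → Fin n) {ι : Type*} {R : Set (Tup n (coords F S))}
    {f : ι → Set (Tup n (coords F S))} (h : R ⊆ ⋃ i, f i) :
    restrictRel n F hST z R ⊆ ⋃ i, restrictRel n F hST z (f i) := by
  rintro x ⟨y, hy, hyx⟩
  obtain ⟨i, hi⟩ := Set.mem_iUnion.1 (h hy)
  exact Set.mem_iUnion.2 ⟨i, y, hi, hyx⟩

lemma pchi_restrictRel_le {n : ℕ} (hn : 0 < n) {θ : Sym2 V → ℝ} {S T : Set V} (hST : S ⊆ T)
    (z : V → Fin n) (A : JoinTree V) (hA : ∀ e ∈ A.graph, 0 ≤ θ e)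
    (R : Set (Tup n (coords A.graph S))) :
    pchi n θ T A (restrictRel n A.graph hST z R) ≤ pchi n θ S A R := by
  induction A with
  | leaf l =>
    obtain ⟨f, hf, hR⟩ := exists_pchi_leaf hn hA R
    exact pchi_leaf_le _ (fun i => (hf i).restrictRel hST z) (restrictRel_subset_iUnion hST z hR)
  | node B C ihB ihC =>
    have hB := graph_mono_of_sub (Sub.left (C := C) (Sub.refl B))
    have hC := graph_mono_of_sub (Sub.right (B := B) (Sub.refl C))
    obtain ⟨m, As, Bs, Cs, h, hR, hsum⟩ := exists_pchi_node hn hA R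
    rw [hsum]
    refine (pchi_node_le (As := fun i => restrictRel n _ hST z (As i))
      (Bs := fun i => restrictRel n _ hST z (Bs i)) (Cs := fun i => restrictRel n _ hST z (Cs i))
      (fun i => ⟨(h i).pathset.restrictRel hST z, (h i).pathset_left.restrictRel hST z,
        (h i).pathset_right.restrictRel hST z,
        fun x hx => projMap_mem_restrictRel hB hST (h i).proj_left hx,
        fun x hx => projMap_mem_restrictRel hC hST (h i).proj_right hx⟩)
      (restrictRel_subset_iUnion hST z hR)).trans (Finset.sum_le_sum fun i _ => ?_)
    exact max_le_max (ihB (fun e he => hA e (hB he)) _) (ihC (fun e he => hA e (hC he)) _)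

lemma pchi_pos {n : ℕ} (hn : 0 < n) {θ : Sym2 V → ℝ} {S : Set V} (A : JoinTree V)
    (hA : ∀ e ∈ A.graph, 0 ≤ θ e) {R : Set (Tup n (coords A.graph S))} (hR : R.Nonempty) :
    0 < pchi n θ S A R := by
  obtain ⟨x, hx⟩ := hR
  induction A with
  | leaf l =>
    obtain ⟨f, -, hcov⟩ := exists_pchi_leaf hn hA R
    obtain ⟨i, -⟩ := Set.mem_iUnion.1 (hcov hx)
    exact i.pos
  | node B C ihB _ =>
    have hB := graph_mono_of_sub (Sub.left (C := C) (Sub.refl B))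
    obtain ⟨m, As, Bs, Cs, h, hcov, hsum⟩ := exists_pchi_node hn hA R
    obtain ⟨i, hi⟩ := Set.mem_iUnion.1 (hcov hx)
    rw [hsum]
    refine Finset.sum_pos' (fun _ _ => Nat.zero_le _) ⟨i, Finset.mem_univ i, ?_⟩
    exact lt_max_of_lt_left (ihB (fun e he => hA e (hB he)) _ ((h i).proj_left x hi))

lemma mu_node_le {n : ℕ} (hn : 0 < n) {θ : Sym2 V → ℝ} {S : Set V} {B C : JoinTree V}
    (hA : ∀ e ∈ (node B C).graph, 0 ≤ θ e) (R : Set (Tup n (coords (node B C).graph S))) {c : ℝ}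
    (h : ∀ A' B' C', IsPathsetJoin n θ S B C A' B' C' →
      mu n A' ≤ c * (max (pchi n θ S B B') (pchi n θ S C C') : ℕ)) :
    mu n R ≤ c * pchi n θ S (node B C) R := by
  obtain ⟨m, As, Bs, Cs, hj, hR, hsum⟩ := exists_pchi_node hn hA R
  rw [hsum, Nat.cast_sum, Finset.mul_sum]
  exact (mu_le_sum (finite_coords _ S) hR).trans (Finset.sum_le_sum fun i _ => h _ _ _ (hj i))

/-- The exponent `c` is admissible for `A|S` if every relation satisfies the density bound
`μ(R) ≤ (1/n)^c · χ_{A|S}(R)`. -/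
def Admissible (n : ℕ) (θ : Sym2 V → ℝ) (A : JoinTree V) (S : Set V) (c : ℝ) : Prop :=
  ∀ R : Set (Tup n (coords A.graph S)), mu n R ≤ ((1 : ℝ) / n) ^ c * (pchi n θ S A R : ℝ)

lemma admissible_zero {n : ℕ} (hn : 0 < n) {θ : Sym2 V → ℝ} {A : JoinTree V}
    (hA : ∀ e ∈ A.graph, 0 ≤ θ e) (S : Set V) : Admissible n θ A S 0 := by
  intro R
  rw [Real.rpow_zero, one_mul]
  rcases R.eq_empty_or_nonempty with rfl | hR
  · simp [mu]
  · have : (1 : ℝ) ≤ pchi n θ S A R := by exact_mod_cast pchi_pos hn A hA hR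
    exact (mu_le_one hn (finite_coords _ S) R).trans this

lemma admissible_atomic {n : ℕ} (hn : 0 < n) {θ : Sym2 V → ℝ} {l : Option (Sym2 V)}
    (hA : ∀ e ∈ (leaf l).graph, 0 ≤ θ e) (S : Set V) :
    Admissible n θ (leaf l) S (Delta θ (elimS (leaf l).graph S)) := by
  intro R
  obtain ⟨f, hf, hR⟩ := exists_pchi_leaf hn hA R
  refine (mu_le_sum (finite_coords _ S) hR).trans
    ((Finset.sum_le_sum fun i _ => (hf i).mu_le hn).trans_eq ?_)
  simp [mul_comm]

lemma Admissible.mu_mul_le_left {n : ℕ} (hn : 0 < n) {θ : Sym2 V → ℝ} {S : Set V}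
    {B : JoinTree V} {F F₂ : Finset (Sym2 V)} {c : ℝ} (hc : Admissible n θ B S c)
    (h₁ : B.graph ⊆ F) (h₂ : F₂ ⊆ F) (hcov : F ⊆ B.graph ∪ F₂)
    {R : Set (Tup n (coords F S))} {P : Set (Tup n (coords B.graph S))}
    {Q : Set (Tup n (coords F₂ S))}
    (hP : ∀ x ∈ R, projMap n (coords_mono h₁ S) x ∈ P)
    (hQ : ∀ x ∈ R, projMap n (coords_mono h₂ S) x ∈ Q) (hQp : IsPathset n θ F₂ S Q) :
    mu n R ≤ ((1 : ℝ) / n) ^ (c + Delta θ (elimS F₂ (S ∪ vset B.graph))) *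
      (pchi n θ S B P : ℝ) := by
  have hn' : (0 : ℝ) < 1 / n := by positivity
  have h := mu_join_le hn h₁ h₂ hcov hP hQ fun z => hQp _ _ z
  refine h.trans ?_
  rw [Real.rpow_add hn', mul_right_comm]
  gcongr
  exact hc P

lemma Admissible.mu_mul_le_right {n : ℕ} (hn : 0 < n) {θ : Sym2 V → ℝ} {S : Set V}
    {C : JoinTree V} (hC : ∀ e ∈ C.graph, 0 ≤ θ e) {F F₁ : Finset (Sym2 V)} {c : ℝ}
    (hc : Admissible n θ C (S ∪ vset F₁) c)
    (h₁ : F₁ ⊆ F) (h₂ : C.graph ⊆ F) (hcov : F ⊆ F₁ ∪ C.graph)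
    {R : Set (Tup n (coords F S))} {P : Set (Tup n (coords F₁ S))}
    {Q : Set (Tup n (coords C.graph S))}
    (hP : ∀ x ∈ R, projMap n (coords_mono h₁ S) x ∈ P)
    (hQ : ∀ x ∈ R, projMap n (coords_mono h₂ S) x ∈ Q) :
    mu n R ≤ mu n P * (((1 : ℝ) / n) ^ c * (pchi n θ S C Q : ℝ)) := by
  refine mu_join_le hn h₁ h₂ hcov hP hQ fun z => (hc _).trans ?_
  gcongr
  exact pchi_restrictRel_le hn _ z C hC Q

lemma mu_projSet_le_sum {n : ℕ} {F F' F'' : Finset (Sym2 V)} (h' : F' ⊆ F) (h'' : F'' ⊆ F')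
    {S : Set V} {R : Set (Tup n (coords F S))} {m : ℕ} {As : Fin m → Set (Tup n (coords F S))}
    {Bs : Fin m → Set (Tup n (coords F' S))}
    (hproj : ∀ i, ∀ x ∈ As i, projMap n (coords_mono h' S) x ∈ Bs i) (hR : R ⊆ ⋃ i, As i) :
    mu n (projSet n (coords_mono (h''.trans h') S) R) ≤
      ∑ i, mu n (projSet n (coords_mono h'' S) (Bs i)) := by
  refine mu_le_sum (finite_coords _ S) ?_
  rintro _ ⟨x, hx, rfl⟩
  obtain ⟨i, hi⟩ := Set.mem_iUnion.1 (hR hx)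
  exact Set.mem_iUnion.2 ⟨i, _, hproj i x hi, rfl⟩

lemma Admissible.mu_projSet_le {n : ℕ} (hn : 0 < n) {θ : Sym2 V → ℝ} {S : Set V}
    {A D : JoinTree V} (hD : Sub D A) (hDS : ¬ vset D.graph ⊆ S) (hA : ∀ e ∈ A.graph, 0 ≤ θ e)
    {c : ℝ} (hc : Admissible n θ D S c) (R : Set (Tup n (coords A.graph S))) :
    mu n (projSet n (coords_mono (graph_mono_of_sub hD) S) R) ≤
      ((1 : ℝ) / n) ^ c * (pchi n θ S A R : ℝ) := by
  induction hD with
  | empty A => exact absurd (by rintro v ⟨e, he, -⟩; simp [graph] at he) hDS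
  | refl A =>
    have : projSet n (coords_mono (graph_mono_of_sub (Sub.refl A)) S) R = R := Set.image_id R
    rw [this]
    exact hc R
  | @left D B C hD ih =>
    have hB := graph_mono_of_sub (Sub.left (C := C) (Sub.refl B))
    obtain ⟨m, As, Bs, Cs, hj, hR, hsum⟩ := exists_pchi_node hn hA R
    rw [hsum, Nat.cast_sum, Finset.mul_sum]
    refine (mu_projSet_le_sum hB (graph_mono_of_sub hD) (fun i => (hj i).proj_left) hR).trans
      (Finset.sum_le_sum fun i _ => (ih hDS (fun e he => hA e (hB he)) hc (Bs i)).trans ?_)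
    gcongr
    exact le_max_left _ _
  | @right D B C hD ih =>
    have hC := graph_mono_of_sub (Sub.right (B := B) (Sub.refl C))
    obtain ⟨m, As, Bs, Cs, hj, hR, hsum⟩ := exists_pchi_node hn hA R
    rw [hsum, Nat.cast_sum, Finset.mul_sum]
    refine (mu_projSet_le_sum hC (graph_mono_of_sub hD) (fun i => (hj i).proj_right) hR).trans
      (Finset.sum_le_sum fun i _ => (ih hDS (fun e he => hA e (hC he)) hc (Cs i)).trans ?_)
    gcongr
    exact le_max_right _ _

lemma Admissible.mu_le_geom_mean {n : ℕ} (hn : 0 < n) {θ : Sym2 V → ℝ} {S : Set V}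
    {A B D : JoinTree V} (hD : Sub D B) (hDS : ¬ vset D.graph ⊆ S) (hBA : B.graph ⊆ A.graph)
    (hA : ∀ e ∈ A.graph, 0 ≤ θ e) {a b : ℝ} (ha : Admissible n θ D S a)
    (hb : Admissible n θ A (S ∪ vset D.graph) b)
    {A' : Set (Tup n (coords A.graph S))} {B' : Set (Tup n (coords B.graph S))} {m : ℕ}
    (hA' : IsPathset n θ A.graph S A')
    (hB' : ∀ x ∈ A', projMap n (coords_mono hBA S) x ∈ B')
    (hmA : pchi n θ S A A' ≤ m) (hmB : pchi n θ S B B' ≤ m) :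
    mu n A' ≤ ((1 : ℝ) / n) ^ ((a + b + Delta θ (elimS A.graph S)) / 2) * (m : ℝ) := by
  have hn' : (0 : ℝ) < 1 / n := by positivity
  have hDB := graph_mono_of_sub hD
  have hproj : mu n (projSet n (coords_mono hDB S) B') ≤ ((1 : ℝ) / n) ^ a * (m : ℝ) := by
    refine (ha.mu_projSet_le hn hD hDS (fun e he => hA e (hBA he)) B').trans ?_
    gcongr
  have h₁ : mu n A' ≤ (((1 : ℝ) / n) ^ a * m) * (((1 : ℝ) / n) ^ b * m) := by
    refine (hb.mu_mul_le_right hn hA (hDB.trans hBA) (Finset.Subset.refl _)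
      Finset.subset_union_right (P := projSet n (coords_mono hDB S) B') (Q := A')
      (fun x hx => ⟨_, hB' x hx, rfl⟩) fun x hx => hx).trans ?_
    gcongr
  have h₂ := hA'.mu_le hn
  refine le_of_sq_le_sq ?_ (by positivity)
  calc mu n A' ^ 2 = mu n A' * mu n A' := sq _
    _ ≤ ((((1 : ℝ) / n) ^ a * m) * (((1 : ℝ) / n) ^ b * m)) *
          ((1 : ℝ) / n) ^ Delta θ (elimS A.graph S) := by
        gcongr
        exact mu_nonneg _
    _ = ((1 : ℝ) / n) ^ (a + b + Delta θ (elimS A.graph S)) * (m : ℝ) ^ 2 := by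
        rw [Real.rpow_add hn', Real.rpow_add hn']
        ring
    _ = _ := by
        rw [mul_pow, ← Real.rpow_mul_natCast hn'.le]
        norm_num

lemma bddAbove_admissible {n : ℕ} (hn : 1 < n) (θ : Sym2 V → ℝ) (A : JoinTree V) (S : Set V) :
    BddAbove {c | Admissible n θ A S c} := by
  have hn₁ : (1 : ℝ) < n := by exact_mod_cast hn
  have hn' : (0 : ℝ) < n := by positivity
  refine ⟨Real.logb n (pchi n θ S A Set.univ), fun c hc => ?_⟩
  have h := hc Set.univ
  rw [mu_univ (by omega) (finite_coords _ S), one_div, Real.inv_rpow hn'.le,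
    ← div_eq_inv_mul, one_le_div (by positivity)] at h
  have hpos : (0 : ℝ) < pchi n θ S A Set.univ := (Real.rpow_pos_of_pos hn' c).trans_le h
  exact (Real.le_logb_iff_rpow_le hn₁ hpos).2 h

/-- The largest admissible exponent for `A|S`. -/
def optExponent (n : ℕ) (θ : Sym2 V → ℝ) (A : JoinTree V) (S : Set V) : ℝ :=
  sSup {c | Admissible n θ A S c}

lemma Admissible.le_optExponent {n : ℕ} (hn : 1 < n) {θ : Sym2 V → ℝ} {A : JoinTree V}
    {S : Set V} {c : ℝ} (hc : Admissible n θ A S c) : c ≤ optExponent n θ A S :=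
  le_csSup (bddAbove_admissible hn θ A S) hc

lemma admissible_optExponent {n : ℕ} (hn : 1 < n) {θ : Sym2 V → ℝ} {A : JoinTree V}
    (hA : ∀ e ∈ A.graph, 0 ≤ θ e) (S : Set V) : Admissible n θ A S (optExponent n θ A S) := by
  have hn₀ : 0 < n := by omega
  have hn' : (1 : ℝ) / n ≠ 0 := by positivity
  have hclosed : IsClosed {c | Admissible n θ A S c} := by
    have : {c | Admissible n θ A S c} = ⋂ R : Set (Tup n (coords A.graph S)),
        {c | mu n R ≤ ((1 : ℝ) / n) ^ c * (pchi n θ S A R : ℝ)} := by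
      ext c; simp [Admissible]
    rw [this]
    exact isClosed_iInter fun R => isClosed_le continuous_const
      ((Real.continuous_const_rpow hn').mul continuous_const)
  exact hclosed.csSup_mem ⟨0, admissible_zero hn₀ hA S⟩ (bddAbove_admissible hn θ A S)

lemma phi2Ok_optExponent {n : ℕ} (hn : 1 < n) {E : Set (Sym2 V)} {θ : Sym2 V → ℝ}
    (hθ : ∀ e ∈ E, 0 ≤ θ e) : Phi2Ok E θ (optExponent n θ) := by
  have hn₀ : 0 < n := by omega
  have hB : ∀ B C : JoinTree V, B.graph ⊆ (node B C).graph := fun B C =>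
    graph_mono_of_sub (Sub.left (Sub.refl B))
  have hC : ∀ B C : JoinTree V, C.graph ⊆ (node B C).graph := fun B C =>
    graph_mono_of_sub (Sub.right (Sub.refl C))
  have hpos : ∀ {A : JoinTree V}, Over E A → ∀ e ∈ A.graph, 0 ≤ θ e :=
    fun h e he => hθ e (h he)
  have opt : ∀ {A D : JoinTree V}, Over E A → D.graph ⊆ A.graph → ∀ T : Set V,
      Admissible n θ D T (optExponent n θ D T) := fun h hD T =>
    admissible_optExponent hn (fun e he => hpos h e (hD he)) T
  refine ⟨fun A S h => (admissible_zero hn₀ (hpos h) S).le_optExponent hn, ?_, ?_, ?_, ?_, ?_, ?_⟩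
  · rintro _ S h ⟨l, rfl⟩
    exact (admissible_atomic hn₀ (hpos h) S).le_optExponent hn
  · refine fun B C S h => Admissible.le_optExponent hn fun R =>
      mu_node_le hn₀ (hpos h) R fun A' B' C' hj => ?_
    refine ((opt h (hB B C) S).mu_mul_le_left hn₀ (hB B C) (hC B C) (Finset.Subset.refl _)
      hj.proj_left hj.proj_right hj.pathset_right).trans ?_
    gcongr
    exact le_max_left _ _
  · refine fun B C S h => Admissible.le_optExponent hn fun R =>
      mu_node_le hn₀ (hpos h) R fun A' B' C' hj => ?_
    refine ((opt h (hC B C) S).mu_mul_le_left hn₀ (hC B C) (hB B C)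
      (Finset.union_comm _ _).subset hj.proj_right hj.proj_left hj.pathset_left).trans ?_
    gcongr
    exact le_max_right _ _
  · refine fun B C S h => Admissible.le_optExponent hn fun R =>
      mu_node_le hn₀ (hpos h) R fun A' B' C' hj => ?_
    refine ((opt h (hC B C) _).mu_mul_le_right hn₀ (fun e he => hpos h e (hC B C he)) (hB B C)
      (hC B C) (Finset.Subset.refl _) hj.proj_left hj.proj_right).trans ?_
    rw [Real.rpow_add (by positivity), mul_assoc]
    gcongr
    · exact hj.pathset_left.mu_le hn₀
    · exact le_max_right _ _
  · refine fun B C S h => Admissible.le_optExponent hn fun R =>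
      mu_node_le hn₀ (hpos h) R fun A' B' C' hj => ?_
    refine ((opt h (hB B C) _).mu_mul_le_right hn₀ (fun e he => hpos h e (hB B C he)) (hC B C)
      (hB B C) (Finset.union_comm _ _).subset hj.proj_right hj.proj_left).trans ?_
    rw [Real.rpow_add (by positivity), mul_assoc]
    gcongr
    · exact hj.pathset_right.mu_le hn₀
    · exact le_max_left _ _
  · rintro A D S h ⟨hD, hne⟩ hDS
    have hDA := graph_mono_of_sub hD
    have ha := opt h hDA S
    have hb := opt h (Finset.Subset.refl _) (S ∪ vset D.graph)
    cases hD with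
    | empty => exact absurd (by rintro v ⟨e, he, -⟩; simp [graph] at he) hDS
    | refl => exact absurd rfl hne
    | @left _ B C hD =>
      exact Admissible.le_optExponent hn fun R => mu_node_le hn₀ (hpos h) R fun A' B' C' hj =>
        ha.mu_le_geom_mean hn₀ hD hDS (hB B C) (hpos h) hb hj.pathset hj.proj_left
          hj.pchi_le (le_max_left _ _)
    | @right _ B C hD =>
      exact Admissible.le_optExponent hn fun R => mu_node_le hn₀ (hpos h) R fun A' B' C' hj =>
        ha.mu_le_geom_mean hn₀ hD hDS (hC B C) (hpos h) hb hj.pathset hj.proj_right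
          hj.pchi_le (le_max_right _ _)

lemma Phi2Ok.phi2_le {E : Set (Sym2 V)} {θ : Sym2 V → ℝ} {g : JoinTree V → Set V → ℝ}
    (hg : Phi2Ok E θ g) {A : JoinTree V} (hA : Over E A) (S : Set V) : Phi2 E θ A S ≤ g A S := by
  refine csInf_le ⟨0, ?_⟩ ⟨g, hg, rfl⟩
  rintro _ ⟨g', hg', rfl⟩
  exact hg'.1 A S hA

/-- For every join-tree `A` over `G`, every `S ⊆ V(G)` and every
relation `𝒜 ⊆ [n]^{A|S}`, `μ(𝒜) ≤ (1/n)^{Φ_θ(A|S)} · χ_{A|S}(𝒜)`. -/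
theorem stmt12 {V : Type*} (Eg : Set (Sym2 V)) (θ : Sym2 V → ℝ)
    (hθ : IsThresholdWeighting Eg θ) (n : ℕ) (hn : 0 < n)
    (A : JoinTree V) (hover : Over Eg A) (S : Set V)
    (R : Set (Tup n (coords A.graph S))) :
    mu n R ≤ ((1 : ℝ) / n) ^ (Phi2 Eg θ A S) * (pchi n θ S A R : ℝ) := by
  have hpos : ∀ e ∈ Eg, 0 ≤ θ e := fun e he => (hθ.1 e he).1
  have hA : ∀ e ∈ A.graph, 0 ≤ θ e := fun e he => hpos e (hover he)
  rcases (show 1 ≤ n from hn).eq_or_lt with rfl | hn₁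
  · simpa using admissible_zero hn hA S R
  · refine (admissible_optExponent hn₁ hA S R).trans ?_
    have hn' : (1 : ℝ) ≤ n := by exact_mod_cast hn
    refine mul_le_mul_of_nonneg_right (Real.rpow_le_rpow_of_exponent_ge (by positivity)
      ((div_le_one (by positivity)).2 hn') ?_) (Nat.cast_nonneg _)
    exact (phi2Ok_optExponent hn₁ hpos).phi2_le hover S

end Paper

end
end

section
/- Let c = √5 + 5, δ = (c−3)/c, and ε = 1/2, and let Φ be the two-parameter potential function over P_∞ with the constant threshold weighting θ ≡ 1. For every join-tree A over P_∞, every finite set S ⊆ ℤ, and every component K of Gr(A)|S of length k: if K is open then Φ(A|S) ≥ log_c(ε·δ·k) + Δ(Gr(A) ⊖ (S ∪ V(K))); if K is half-open then Φ(A|S) ≥ log_c(δ·k) + Δ(Gr(A) ⊖ (S ∪ V(K))); and if K is closed then Φ(A|S) ≥ log_c(k) + Δ(Gr(A) ⊖ (S ∪ V(K))). -/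
open scoped Classical

noncomputable section

namespace Paper

variable {V : Type*}

open JoinTree

/-- The edge set of the two-way infinite path `P_∞` on vertex set `ℤ`. -/
def EPinf : Set (Sym2 ℤ) := { e | ∃ i : ℤ, e = s(i, i + 1) }

/-- The constant threshold weighting `θ ≡ 1` on `P_∞`. -/
def theta1 : Sym2 ℤ → ℝ := fun _ => 1

/-- `P_{i,j} ⊆ F`: all edges of the path from `i` to `j` belong to `F`. -/
def pathIn (F : Finset (Sym2 ℤ)) (i j : ℤ) : Prop :=
  ∀ m : ℤ, i ≤ m → m < j → s(m, m + 1) ∈ F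

/-- `(i,j)` is an open component of `F|S`. -/
def OpenComp (F : Finset (Sym2 ℤ)) (S : Set ℤ) (i j : ℤ) : Prop :=
  i < j ∧ pathIn F i j ∧ ∀ m : ℤ, i ≤ m → m ≤ j → (m ∈ S ↔ m = i ∨ m = j)

/-- `[i,j)` is a half-open component of `F|S`. -/
def HOLComp (F : Finset (Sym2 ℤ)) (S : Set ℤ) (i j : ℤ) : Prop :=
  i < j ∧ pathIn F i j ∧ (∀ m : ℤ, i ≤ m → m ≤ j → (m ∈ S ↔ m = i)) ∧ s(j, j + 1) ∉ F

/-- `(i,j]` is a half-open component of `F|S`. -/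
def HORComp (F : Finset (Sym2 ℤ)) (S : Set ℤ) (i j : ℤ) : Prop :=
  i < j ∧ pathIn F i j ∧ (∀ m : ℤ, i ≤ m → m ≤ j → (m ∈ S ↔ m = j)) ∧ s(i - 1, i) ∉ F

/-- `[i,j]` is a closed component of `F|S`. -/
def ClosedComp (F : Finset (Sym2 ℤ)) (S : Set ℤ) (i j : ℤ) : Prop :=
  i < j ∧ pathIn F i j ∧ (∀ m : ℤ, i ≤ m → m ≤ j → m ∉ S) ∧
    s(i - 1, i) ∉ F ∧ s(j, j + 1) ∉ F

/-- The number of closed components of `F|S`. -/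
def closedCount (F : Finset (Sym2 ℤ)) (S : Set ℤ) : ℕ :=
  {p : ℤ × ℤ | ClosedComp F S p.1 p.2}.ncard

/-- `λ(F)`: the number of edges of the largest connected component of `F`
(the length of the longest path in a subgraph of `P_∞`). -/
def lamP (F : Finset (Sym2 ℤ)) : ℕ :=
  sSup { m | ∃ v ∈ vset F,
    m = (F.filter fun e =>
      ∃ u ∈ e, (SimpleGraph.fromEdgeSet (F : Set (Sym2 ℤ))).Reachable u v).card }

/-- The edge set of the path `P_k` with vertices `0, 1, …, k`. -/
def PkF (k : ℕ) : Finset (Sym2 ℤ) :=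
  (Finset.range k).image fun i => s((i : ℤ), (i : ℤ) + 1)

/-- The edge `{m, m + 1}` belongs to `F`. -/
def HasEdge (F : Finset (Sym2 ℤ)) (m : ℤ) : Prop := s(m, m + 1) ∈ F

lemma exists_first {P : ℤ → Prop} {a b : ℤ} (hab : a ≤ b) (hb : P b) :
    ∃ r, a ≤ r ∧ r ≤ b ∧ P r ∧ ∀ m, a ≤ m → m < r → ¬ P m := by
  obtain ⟨r, ⟨har, hr⟩, hmin⟩ := Int.exists_least_of_bdd (P := fun z => a ≤ z ∧ P z)
    ⟨a, fun z hz => hz.1⟩ ⟨b, hab, hb⟩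
  refine ⟨r, har, hmin b ⟨hab, hb⟩, hr, fun m hm hmr hP => ?_⟩
  have := hmin m ⟨hm, hP⟩
  omega

lemma exists_last {P : ℤ → Prop} {a b : ℤ} (hab : a ≤ b) (ha : P a) :
    ∃ r, a ≤ r ∧ r ≤ b ∧ P r ∧ ∀ m, r < m → m ≤ b → ¬ P m := by
  obtain ⟨r, ⟨hrb, hr⟩, hmax⟩ := Int.exists_greatest_of_bdd (P := fun z => z ≤ b ∧ P z)
    ⟨b, fun z hz => hz.1⟩ ⟨a, hab, ha⟩
  refine ⟨r, hmax a ⟨hab, ha⟩, hrb, hr, fun m hm hmr hP => ?_⟩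
  have := hmax m ⟨hmr, hP⟩
  omega

lemma edge_injective : Function.Injective (fun m : ℤ => s(m, m + 1)) := by
  intro a b h
  simp only [Sym2.eq_iff] at h
  omega

lemma finite_hasEdge (F : Finset (Sym2 ℤ)) : {m | HasEdge F m}.Finite :=
  F.finite_toSet.preimage edge_injective.injOn

lemma exists_run_end {F : Finset (Sym2 ℤ)} {a : ℤ} (ha : HasEdge F a) :
    ∃ r, a < r ∧ pathIn F a r ∧ ¬ HasEdge F r := by
  obtain ⟨M, hM⟩ := (finite_hasEdge F).bddAbove
  have haM : a ≤ M := hM ha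
  have hlast : ¬ HasEdge F (M + 1) := fun h => by
    have : M + 1 ≤ M := hM h
    omega
  obtain ⟨r, har, -, hr, hmin⟩ := exists_first (P := fun m => ¬ HasEdge F m)
    (show a ≤ M + 1 by omega) hlast
  refine ⟨r, lt_of_le_of_ne har ?_, fun m h1 h2 => not_not.mp (hmin m h1 h2), hr⟩
  rintro rfl
  exact hr ha

lemma edge_sub_one (F : Finset (Sym2 ℤ)) (m : ℤ) : s(m - 1, m) ∈ F ↔ HasEdge F (m - 1) := by
  rw [HasEdge, sub_add_cancel]

lemma mem_vset_iff {F : Finset (Sym2 ℤ)} (hF : (F : Set (Sym2 ℤ)) ⊆ EPinf) (v : ℤ) :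
    v ∈ vset F ↔ HasEdge F (v - 1) ∨ HasEdge F v := by
  constructor
  · rintro ⟨e, he, hv⟩
    obtain ⟨i, rfl⟩ := hF he
    rcases Sym2.mem_iff.mp hv with rfl | rfl
    · exact Or.inr he
    · left
      rw [add_sub_cancel_right]
      exact he
  · rintro (h | h)
    · exact ⟨_, h, by simp⟩
    · exact ⟨_, h, by simp⟩

lemma reachable_of_path {F : Finset (Sym2 ℤ)} {u : ℤ} (n : ℕ) (h : pathIn F u (u + n)) :
    (SimpleGraph.fromEdgeSet (F : Set (Sym2 ℤ))).Reachable u (u + n) := by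
  induction n with
  | zero => simp
  | succ n ih =>
    refine (ih fun m h1 h2 => h m h1 (by push_cast; omega)).trans
      (SimpleGraph.Adj.reachable ?_)
    rw [SimpleGraph.fromEdgeSet_adj]
    push_cast
    rw [← add_assoc]
    exact ⟨h _ (by omega) (by push_cast; omega), by omega⟩

lemma reachable_of_pathIn {F : Finset (Sym2 ℤ)} {u w : ℤ} (huw : u ≤ w) (h : pathIn F u w) :
    (SimpleGraph.fromEdgeSet (F : Set (Sym2 ℤ))).Reachable u w := by
  obtain ⟨n, rfl⟩ := Int.le.dest huw
  exact reachable_of_path n h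

lemma pathIn_of_reachable {F : Finset (Sym2 ℤ)} (hF : (F : Set (Sym2 ℤ)) ⊆ EPinf) {u w : ℤ}
    (h : (SimpleGraph.fromEdgeSet (F : Set (Sym2 ℤ))).Reachable u w) :
    pathIn F u w ∧ pathIn F w u := by
  obtain ⟨p⟩ := h
  induction p with
  | nil => exact ⟨fun m h1 h2 => by omega, fun m h1 h2 => by omega⟩
  | @cons a b d hab p ih =>
    rw [SimpleGraph.fromEdgeSet_adj] at hab
    obtain ⟨hmem, -⟩ := hab
    obtain ⟨i, hi⟩ := hF hmem
    have hi' : s(i, i + 1) ∈ F := by rw [← hi]; exact hmem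
    rw [Sym2.eq_iff] at hi
    constructor
    · intro m h1 h2
      by_cases hmi : m = i
      · rw [hmi]; exact hi'
      · exact ih.1 m (by omega) h2
    · intro m h1 h2
      by_cases hmi : m = i
      · rw [hmi]; exact hi'
      · exact ih.2 m h1 (by omega)

/-- The left endpoints of the closed components of `F|S`. -/
def starts (F : Finset (Sym2 ℤ)) (S : Set ℤ) : Set ℤ := {l | ∃ r, ClosedComp F S l r}

lemma hasEdge_of_mem_starts {F : Finset (Sym2 ℤ)} {S : Set ℤ} {l : ℤ} (h : l ∈ starts F S) :
    HasEdge F l := by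
  obtain ⟨r, hlr, hp, -⟩ := h
  exact hp l le_rfl hlr

lemma finite_starts (F : Finset (Sym2 ℤ)) (S : Set ℤ) : (starts F S).Finite :=
  (finite_hasEdge F).subset fun _ h => hasEdge_of_mem_starts h

lemma hasEdge_elimS {F : Finset (Sym2 ℤ)} {S : Set ℤ} {v : ℤ} :
    HasEdge (elimS F S) v ↔ HasEdge F v ∧
      ∀ s ∈ S, ¬ (SimpleGraph.fromEdgeSet (F : Set (Sym2 ℤ))).Reachable v s := by
  unfold HasEdge elimS
  rw [Finset.mem_filter]
  refine and_congr_right fun hv => ⟨fun h => h v (by simp), fun h w hw s hs hr => ?_⟩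
  rcases Sym2.mem_iff.mp hw with rfl | rfl
  · exact h s hs hr
  · refine h s hs (SimpleGraph.Reachable.trans ?_ hr)
    exact reachable_of_pathIn (by omega) fun m h1 h2 => by
      obtain rfl : m = v := by omega
      exact hv

lemma leftEnds_elimS {F : Finset (Sym2 ℤ)} (hF : (F : Set (Sym2 ℤ)) ⊆ EPinf) (S : Set ℤ) :
    {v | HasEdge (elimS F S) v ∧ ¬ HasEdge (elimS F S) (v - 1)} = starts F S := by
  ext v
  simp only [Set.mem_ofPred_eq, hasEdge_elimS]
  constructor
  · rintro ⟨⟨hv, hS⟩, h⟩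
    have hleft : ¬ HasEdge F (v - 1) := by
      intro hv'
      refine h ⟨hv', fun s hs hr => hS s hs (SimpleGraph.Reachable.trans
        (SimpleGraph.Reachable.symm ?_) hr)⟩
      refine reachable_of_pathIn (by omega) fun m h1 h2 => ?_
      obtain rfl : m = v - 1 := by omega
      exact hv'
    obtain ⟨r, hvr, hp, hr⟩ := exists_run_end hv
    refine ⟨r, hvr, hp, fun m h1 h2 hm => hS m hm ?_, (edge_sub_one F v).not.mpr hleft, hr⟩
    exact reachable_of_pathIn h1 fun k h3 h4 => hp k h3 (by omega)
  · rintro ⟨r, hvr, hp, hS, hl, hr⟩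
    rw [edge_sub_one] at hl
    refine ⟨⟨hp v le_rfl hvr, fun s hs hreach => ?_⟩, fun h => hl h.1⟩
    obtain ⟨h1, h2⟩ := pathIn_of_reachable hF hreach
    by_cases hsv : s < v
    · exact hl (h2 (v - 1) (by omega) (by omega))
    by_cases hrs : r < s
    · exact hr (h1 r (by omega) hrs)
    exact hS s (by omega) (by omega) hs

lemma card_eq_ncard {G : Finset (Sym2 ℤ)} (hG : (G : Set (Sym2 ℤ)) ⊆ EPinf) :
    G.card = {v | HasEdge G (v - 1)}.ncard := by
  rw [← Set.ncard_coe_finset,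
    ← Set.ncard_image_of_injective {v | HasEdge G (v - 1)}
      (f := fun v : ℤ => s(v - 1, v - 1 + 1))
      (edge_injective.comp (sub_left_injective (b := (1 : ℤ))))]
  congr 1
  ext e
  constructor
  · intro he
    obtain ⟨i, rfl⟩ := hG he
    exact ⟨i + 1, by simpa [HasEdge] using he, by simp⟩
  · rintro ⟨v, hv, rfl⟩
    exact hv

lemma delta_elimS {F : Finset (Sym2 ℤ)} (hF : (F : Set (Sym2 ℤ)) ⊆ EPinf) (S : Set ℤ) :
    Delta theta1 (elimS F S) = (starts F S).ncard := by
  have hG : ((elimS F S : Finset (Sym2 ℤ)) : Set (Sym2 ℤ)) ⊆ EPinf := fun e he =>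
    hF (Finset.mem_filter.mp he).1
  have hfin : {v | HasEdge (elimS F S) (v - 1)}.Finite :=
    (elimS F S).finite_toSet.preimage
      (edge_injective.comp (sub_left_injective (b := (1 : ℤ)))).injOn
  have hv : vset (elimS F S) = {v | HasEdge (elimS F S) (v - 1)} ∪ starts F S := by
    rw [← leftEnds_elimS hF S]
    ext v
    rw [mem_vset_iff hG]
    simp only [Set.mem_union, Set.mem_ofPred_eq]
    tauto
  have hdisj : Disjoint {v | HasEdge (elimS F S) (v - 1)} (starts F S) := by
    rw [← leftEnds_elimS hF S, Set.disjoint_left]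
    rintro v hv ⟨-, h⟩
    exact h hv
  unfold Delta
  rw [hv, Set.ncard_union_eq hdisj hfin (finite_starts F S), ← card_eq_ncard hG]
  simp [theta1]

/-- The number of closed components of `F|S` whose left endpoint lies in `T`. -/
def closedIn (F : Finset (Sym2 ℤ)) (S T : Set ℤ) : ℕ := (starts F S ∩ T).ncard

lemma delta_eq_closedIn {F : Finset (Sym2 ℤ)} (hF : (F : Set (Sym2 ℤ)) ⊆ EPinf) (S T : Set ℤ) :
    Delta theta1 (elimS F S) = closedIn F S T + closedIn F S Tᶜ := by
  rw [delta_elimS hF, ← Set.ncard_inter_add_ncard_sdiff_eq_ncard _ T (finite_starts F S)]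
  push_cast
  rfl

lemma closedIn_mono (F : Finset (Sym2 ℤ)) (S : Set ℤ) {T T' : Set ℤ} (h : T ⊆ T') :
    closedIn F S T ≤ closedIn F S T' :=
  Set.ncard_le_ncard (Set.inter_subset_inter_right _ h) ((finite_starts F S).inter_of_left _)

lemma closedIn_univ {F : Finset (Sym2 ℤ)} (hF : (F : Set (Sym2 ℤ)) ⊆ EPinf) (S : Set ℤ) :
    Delta theta1 (elimS F S) = closedIn F S Set.univ := by
  rw [delta_elimS hF, closedIn, Set.inter_univ]

lemma closedIn_le_add {A B C : Finset (Sym2 ℤ)} {S T : Set ℤ}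
    (hB : (B : Set (Sym2 ℤ)) ⊆ EPinf) (hBA : B ⊆ A) (hCA : C ⊆ A)
    (hA : ∀ m, HasEdge A m → HasEdge B m ∨ HasEdge C m)
    (hT : ∀ l r, l ∈ T → ClosedComp A S l r → Set.Icc l r ⊆ T) :
    closedIn A S T ≤ closedIn B S T + closedIn C (S ∪ vset B) T := by
  let R : ℤ → ℤ → Prop := fun l' l => l ≤ l' ∧ pathIn A l l' ∧ ¬ HasEdge A (l - 1)
  have huniq : ∀ l' l₁ l₂, R l' l₁ → R l' l₂ → l₁ = l₂ := by
    rintro l' l₁ l₂ ⟨h1, h2, h3⟩ ⟨k1, k2, k3⟩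
    rcases lt_trichotomy l₁ l₂ with h | h | h
    · exact absurd (h2 (l₂ - 1) (by omega) (by omega)) k3
    · exact h
    · exact absurd (k2 (l₁ - 1) (by omega) (by omega)) h3
  let φ : ℤ → ℤ := fun l' => if h : ∃ l, R l' l then h.choose else 0
  have hφ : ∀ l' l, R l' l → φ l' = l := by
    intro l' l h
    have hex : ∃ l, R l' l := ⟨l, h⟩
    simp only [φ, dif_pos hex]
    exact huniq _ _ _ hex.choose_spec h
  have hfB : (starts B S ∩ T).Finite := (finite_starts B S).inter_of_left _
  have hfC : (starts C (S ∪ vset B) ∩ T).Finite := (finite_starts C _).inter_of_left _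
  have hsub : starts A S ∩ T ⊆
      φ '' (starts B S ∩ T) ∪ φ '' (starts C (S ∪ vset B) ∩ T) := by
    rintro l ⟨⟨r, hcc⟩, hlT⟩
    have hIcc := hT l r hlT hcc
    obtain ⟨hlr, hp, hS, hl, hr⟩ := hcc
    rw [edge_sub_one] at hl
    by_cases hex : ∃ m, l ≤ m ∧ m < r ∧ HasEdge B m
    · obtain ⟨m₀, h1, h2, h3⟩ := hex
      obtain ⟨m, hlm, hm, hBm, hfirst⟩ := exists_first (P := HasEdge B) h1 h3
      obtain ⟨r', hmr', hp', hr'⟩ := exists_run_end hBm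
      have hr'r : r' ≤ r := by
        by_contra hcon
        exact hr (hBA (hp' r (by omega) (by omega)))
      refine Or.inl ⟨m, ⟨⟨r', hmr', hp', fun k h4 h5 => hS k (by omega) (by omega), ?_, hr'⟩,
        hIcc ⟨hlm, by omega⟩⟩, hφ m l ⟨hlm, fun k h4 h5 => hp k h4 (by omega), hl⟩⟩
      rw [edge_sub_one]
      rcases eq_or_lt_of_le hlm with rfl | hlt
      · exact fun h => hl (hBA h)
      · exact hfirst (m - 1) (by omega) (by omega)
    · refine Or.inr ⟨l, ⟨⟨r, hlr, fun m h1 h2 => ?_, fun m h1 h2 => ?_, ?_, fun h => hr (hCA h)⟩,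
        hlT⟩, hφ l l ⟨le_rfl, fun m h1 h2 => by omega, hl⟩⟩
      · exact (hA m (hp m h1 h2)).resolve_left fun h => hex ⟨m, h1, h2, h⟩
      · rintro (h | h)
        · exact hS m h1 h2 h
        · rw [mem_vset_iff hB] at h
          rcases h with h | h
          · rcases eq_or_lt_of_le h1 with rfl | hlt
            · exact hl (hBA h)
            · exact hex ⟨m - 1, by omega, by omega, h⟩
          · rcases eq_or_lt_of_le h2 with rfl | hlt
            · exact hr (hBA h)
            · exact hex ⟨m, h1, hlt, h⟩
      · rw [edge_sub_one]
        exact fun h => hl (hCA h)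
  calc closedIn A S T ≤ _ := Set.ncard_le_ncard hsub ((hfB.image φ).union (hfC.image φ))
    _ ≤ _ := Set.ncard_union_le _ _
    _ ≤ _ := add_le_add (Set.ncard_image_le hfB) (Set.ncard_image_le hfC)

namespace JoinTree

/-- `Desc D A` means that `D` is the sub-join-tree rooted at some node of `A`. -/
inductive Desc : JoinTree ℤ → JoinTree ℤ → Prop
  | refl (A : JoinTree ℤ) : Desc A A
  | left {D B C : JoinTree ℤ} : Desc D B → Desc D (node B C)
  | right {D B C : JoinTree ℤ} : Desc D C → Desc D (node B C)

/-- `D` is a node whose two children are `E` and `F`, in either order. -/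
def HasChildren (D E F : JoinTree ℤ) : Prop := D = node E F ∨ D = node F E

lemma Desc.sub {D A : JoinTree ℤ} (h : Desc D A) : Sub D A := by
  induction h with
  | refl => exact Sub.refl _
  | left _ ih => exact Sub.left ih
  | right _ ih => exact Sub.right ih

lemma Desc.trans {E D A : JoinTree ℤ} (h : Desc E D) (h' : Desc D A) : Desc E A := by
  induction h' with
  | refl => exact h
  | left _ ih => exact Desc.left ih
  | right _ ih => exact Desc.right ih

lemma Desc.sizeOf_le {D A : JoinTree ℤ} (h : Desc D A) : sizeOf D ≤ sizeOf A := by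
  induction h with
  | refl => exact le_rfl
  | left _ ih => simp only [node.sizeOf_spec]; omega
  | right _ ih => simp only [node.sizeOf_spec]; omega

lemma Desc.graph_subset {D A : JoinTree ℤ} (h : Desc D A) : D.graph ⊆ A.graph :=
  graph_mono_of_sub h.sub

lemma HasChildren.swap {D E F : JoinTree ℤ} (h : HasChildren D E F) : HasChildren D F E :=
  h.symm

lemma HasChildren.desc {D E F : JoinTree ℤ} (h : HasChildren D E F) : Desc E D := by
  rcases h with rfl | rfl
  · exact Desc.left (Desc.refl E)
  · exact Desc.right (Desc.refl E)

lemma HasChildren.sizeOf_lt {D E F : JoinTree ℤ} (h : HasChildren D E F) :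
    sizeOf E < sizeOf D := by
  rcases h with rfl | rfl <;> simp only [node.sizeOf_spec] <;> omega

lemma mem_graph_node {e : Sym2 V} {B C : JoinTree V} :
    e ∈ (node B C).graph ↔ e ∈ B.graph ∨ e ∈ C.graph := Finset.mem_union

lemma HasChildren.hasEdge {D E F : JoinTree ℤ} (h : HasChildren D E F) {m : ℤ}
    (hm : HasEdge D.graph m) : HasEdge E.graph m ∨ HasEdge F.graph m := by
  rcases h with rfl | rfl
  · exact mem_graph_node.mp hm
  · exact (mem_graph_node.mp hm).symm

lemma Over.desc {E : Set (Sym2 ℤ)} {D A : JoinTree ℤ} (hA : Over E A) (h : Desc D A) :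
    Over E D := fun _ he => hA (h.graph_subset he)

/-- The number of leaves. -/
def leaves : JoinTree V → ℕ
  | leaf _ => 1
  | node B C => leaves B + leaves C

/-- The total number of leaves below all nodes, a crude upper bound for the potential. -/
def leafWeight : JoinTree ℤ → ℕ
  | leaf _ => 1
  | node B C => leafWeight B + leafWeight C + leaves B + leaves C

lemma card_graph_le_leaves : ∀ A : JoinTree V, A.graph.card ≤ A.leaves
  | leaf none => by simp [graph, leaves]
  | leaf (some e) => by simp [graph, leaves]
  | node B C => (Finset.card_union_le _ _).trans
      (add_le_add (card_graph_le_leaves B) (card_graph_le_leaves C))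

lemma leaves_le_leafWeight : ∀ A : JoinTree ℤ, A.leaves ≤ A.leafWeight
  | leaf _ => by simp [leaves, leafWeight]
  | node B C => by simp only [leaves, leafWeight]; omega

lemma Sub.leafWeight_le {D A : JoinTree ℤ} (h : Sub D A) (hD : D ≠ leaf none) :
    D.leafWeight ≤ A.leafWeight := by
  induction h with
  | empty A => exact absurd rfl hD
  | refl A => exact le_rfl
  | left _ ih => have := ih hD; simp only [leafWeight]; omega
  | right _ ih => have := ih hD; simp only [leafWeight]; omega

end JoinTree

lemma delta_elimS_le_leaves {A : JoinTree ℤ} (hA : Over EPinf A) (S : Set ℤ) :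
    Delta theta1 (elimS A.graph S) ≤ A.leaves := by
  rw [delta_elimS hA]
  have h1 : (starts A.graph S).ncard ≤ {m | HasEdge A.graph m}.ncard :=
    Set.ncard_le_ncard (fun _ h => hasEdge_of_mem_starts h) (finite_hasEdge _)
  have h2 : {m | HasEdge A.graph m}.ncard ≤ A.graph.card := by
    rw [← Set.ncard_coe_finset, ← Set.ncard_image_of_injective _ edge_injective]
    refine Set.ncard_le_ncard ?_ A.graph.finite_toSet
    rintro _ ⟨m, hm, rfl⟩
    exact hm
  exact_mod_cast (h1.trans h2).trans (card_graph_le_leaves A)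

lemma vset_leaf_none : vset (graph (leaf none : JoinTree ℤ)) = ∅ := by
  ext v
  simp [vset, graph]

lemma phi2Ok_leafWeight : Phi2Ok EPinf theta1 fun A _ => (A.leafWeight : ℝ) := by
  have hleft : ∀ {B C : JoinTree ℤ}, Over EPinf (node B C) → Over EPinf B :=
    fun h => h.desc (Desc.left (Desc.refl _))
  have hright : ∀ {B C : JoinTree ℤ}, Over EPinf (node B C) → Over EPinf C :=
    fun h => h.desc (Desc.right (Desc.refl _))
  have hpot : ∀ {A : JoinTree ℤ} (S : Set ℤ), Over EPinf A →
      Delta theta1 (elimS A.graph S) ≤ A.leafWeight := fun S hA =>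
    (delta_elimS_le_leaves hA S).trans (by exact_mod_cast leaves_le_leafWeight _)
  refine ⟨fun A S _ => by positivity, fun A S hA _ => hpot S hA, ?_, ?_, ?_, ?_, ?_⟩
  · intro B C S h
    have := hpot (S ∪ vset B.graph) (hright h)
    simp only [leafWeight]
    push_cast
    have h1 : (0 : ℝ) ≤ B.leaves := by positivity
    have h2 : (0 : ℝ) ≤ C.leaves := by positivity
    linarith
  · intro B C S h
    have := hpot (S ∪ vset C.graph) (hleft h)
    simp only [leafWeight]
    push_cast
    have h1 : (0 : ℝ) ≤ B.leaves := by positivity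
    have h2 : (0 : ℝ) ≤ C.leaves := by positivity
    linarith
  · intro B C S h
    have := hpot S (hleft h)
    simp only [leafWeight]
    push_cast
    have h1 : (0 : ℝ) ≤ B.leaves := by positivity
    have h2 : (0 : ℝ) ≤ C.leaves := by positivity
    linarith
  · intro B C S h
    have := hpot S (hright h)
    simp only [leafWeight]
    push_cast
    have h1 : (0 : ℝ) ≤ B.leaves := by positivity
    have h2 : (0 : ℝ) ≤ C.leaves := by positivity
    linarith
  · rintro A D S hA ⟨hsub, hne⟩ hDS
    have hD : D ≠ leaf none := by
      rintro rfl
      rw [vset_leaf_none] at hDS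
      exact hDS (Set.empty_subset S)
    have hle : D.leafWeight + A.leaves ≤ A.leafWeight := by
      cases hsub with
      | empty => exact absurd rfl hD
      | refl => exact absurd rfl hne
      | left h => have := h.leafWeight_le hD; simp only [leafWeight, leaves]; omega
      | right h => have := h.leafWeight_le hD; simp only [leafWeight, leaves]; omega
    have h1 : (D.leafWeight : ℝ) + A.leaves ≤ A.leafWeight := by exact_mod_cast hle
    have := delta_elimS_le_leaves hA S
    dsimp only
    linarith

lemma le_phi2 {A : JoinTree ℤ} {S : Set ℤ} {x : ℝ}
    (h : ∀ g, Phi2Ok EPinf theta1 g → x ≤ g A S) : x ≤ Phi2 EPinf theta1 A S := by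
  refine le_csInf ⟨_, _, phi2Ok_leafWeight, rfl⟩ ?_
  rintro _ ⟨g, hg, rfl⟩
  exact h g hg

section Potential

variable {g : JoinTree ℤ → Set ℤ → ℝ}

lemma Phi2Ok.dagger (hg : Phi2Ok EPinf theta1 g) {D E F : JoinTree ℤ} (h : HasChildren D E F)
    (hD : Over EPinf D) (S : Set ℤ) :
    g E S + closedIn F.graph (S ∪ vset E.graph) Set.univ ≤ g D S := by
  rw [← closedIn_univ (hD.desc h.swap.desc)]
  rcases h with rfl | rfl
  · exact hg.2.2.1 E F S hD
  · exact hg.2.2.2.1 F E S hD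

lemma Phi2Ok.inverted_dagger (hg : Phi2Ok EPinf theta1 g) {D E F : JoinTree ℤ}
    (h : HasChildren D E F) (hD : Over EPinf D) (S : Set ℤ) :
    closedIn E.graph S Set.univ + g F (S ∪ vset E.graph) ≤ g D S := by
  rw [← closedIn_univ (hD.desc h.desc)]
  rcases h with rfl | rfl
  · exact hg.2.2.2.2.1 E F S hD
  · exact hg.2.2.2.2.2.1 F E S hD

lemma JoinTree.HasChildren.closedIn_le {D E F : JoinTree ℤ} (h : HasChildren D E F)
    (hD : Over EPinf D) {S T : Set ℤ}
    (hT : ∀ l r, l ∈ T → ClosedComp D.graph S l r → Set.Icc l r ⊆ T) :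
    closedIn D.graph S T ≤ closedIn E.graph S T + closedIn F.graph (S ∪ vset E.graph) T :=
  closedIn_le_add (hD.desc h.desc) h.desc.graph_subset h.swap.desc.graph_subset
    (fun _ => h.hasEdge) hT

lemma Phi2Ok.closedIn_le (hg : Phi2Ok EPinf theta1 g) : ∀ {A : JoinTree ℤ} (_ : Over EPinf A)
    (S : Set ℤ), (closedIn A.graph S Set.univ : ℝ) ≤ g A S
  | leaf l, hA, S => by
    rw [← closedIn_univ hA]
    exact hg.2.1 _ S hA ⟨l, rfl⟩
  | node B C, hA, S => by
    have hch : HasChildren (node B C) B C := Or.inl rfl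
    have h1 := Phi2Ok.closedIn_le hg (hA.desc hch.desc) S
    have h2 := hg.dagger hch hA S
    have h3 : (closedIn (node B C).graph S Set.univ : ℝ) ≤ closedIn B.graph S Set.univ +
        closedIn C.graph (S ∪ vset B.graph) Set.univ := by
      exact_mod_cast hch.closedIn_le hA fun _ _ _ _ => Set.subset_univ _
    linarith

lemma Phi2Ok.desc_le (hg : Phi2Ok EPinf theta1 g) {D A : JoinTree ℤ} (h : Desc D A)
    (hA : Over EPinf A) (S : Set ℤ) :
    g D S + closedIn A.graph (S ∪ vset D.graph) Set.univ ≤ g A S := by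
  have hstep : ∀ {D E A F : JoinTree ℤ}, HasChildren A E F → Desc D E → Over EPinf A →
      g D S + closedIn E.graph (S ∪ vset D.graph) Set.univ ≤ g E S →
      g D S + closedIn A.graph (S ∪ vset D.graph) Set.univ ≤ g A S := by
    intro D E A F hch hDE hA ih
    have h1 := hg.dagger hch hA S
    have h2 : (closedIn A.graph (S ∪ vset D.graph) Set.univ : ℝ) ≤
        closedIn E.graph (S ∪ vset D.graph) Set.univ +
        closedIn F.graph (S ∪ vset D.graph ∪ vset E.graph) Set.univ := by
      exact_mod_cast hch.closedIn_le hA fun _ _ _ _ => Set.subset_univ _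
    rw [Set.union_assoc, Set.union_eq_right.mpr (vset_mono hDE.graph_subset)] at h2
    linarith
  induction h with
  | refl =>
    have : closedIn D.graph (S ∪ vset D.graph) Set.univ = 0 := by
      unfold closedIn
      convert Set.ncard_empty ℤ
      rw [Set.inter_univ, Set.eq_empty_iff_forall_notMem]
      rintro l ⟨r, hlr, hp, hS, -⟩
      exact hS l le_rfl hlr.le (Or.inr ((mem_vset_iff hA l).mpr (Or.inr (hp l le_rfl hlr))))
    rw [this]
    simp
  | @left B C hD ih =>
    have hch : HasChildren (node B C) B C := Or.inl rfl
    exact hstep hch hD hA (ih (hA.desc hch.desc))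
  | @right B C hD ih =>
    have hch : HasChildren (node B C) C B := Or.inr rfl
    exact hstep hch hD hA (ih (hA.desc hch.desc))

end Potential

/-- `F` contains the path from `i` to `j`, whose interior avoids `S`, and at each end the path
stops because the endpoint is in `S` or the next edge is missing: `(i, j)` is an open, half-open
or closed component of `F|S`. -/
def Comp (F : Finset (Sym2 ℤ)) (S : Set ℤ) (i j : ℤ) : Prop :=
  i < j ∧ pathIn F i j ∧ (∀ m, i < m → m < j → m ∉ S) ∧
    (i ∈ S ∨ ¬ HasEdge F (i - 1)) ∧ (j ∈ S ∨ ¬ HasEdge F j)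

/-- The factor `1`, `δ` or `δ / 2` of the length of a closed, half-open or open component. -/
def weight (δ : ℝ) (S : Set ℤ) (i j : ℤ) : ℝ :=
  if i ∈ S then if j ∈ S then δ / 2 else δ else if j ∈ S then δ else 1

/-- The indicator of a closed component. -/
def isClosedComp (S : Set ℤ) (i j : ℤ) : ℕ := if i ∈ S ∨ j ∈ S then 0 else 1

lemma weight_pos {δ : ℝ} (hδ : 0 < δ) (S : Set ℤ) (i j : ℤ) : 0 < weight δ S i j := by
  unfold weight
  split_ifs <;> linarith

lemma half_le_weight {δ : ℝ} (hδ : 0 < δ) (hδ1 : δ < 1) (S : Set ℤ) (i j : ℤ) :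
    δ / 2 ≤ weight δ S i j := by
  unfold weight
  split_ifs <;> linarith

lemma weight_le_one {δ : ℝ} (hδ : 0 < δ) (hδ1 : δ < 1) (S : Set ℤ) (i j : ℤ) :
    weight δ S i j ≤ 1 := by
  unfold weight
  split_ifs <;> linarith

lemma Comp.closedIn_le {F : Finset (Sym2 ℤ)} {S : Set ℤ} {i j : ℤ} (h : Comp F S i j) :
    closedIn F S (Set.Icc i j) ≤ isClosedComp S i j := by
  obtain ⟨hij, hp, hS, hi, hj⟩ := h
  have hsub : starts F S ∩ Set.Icc i j ⊆ {l | l = i ∧ i ∉ S ∧ j ∉ S} := by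
    rintro l ⟨⟨r, hlr, hp', hS', hl, hr⟩, hil, hlj⟩
    rw [edge_sub_one] at hl
    have hli : l = i := by
      by_contra hne
      exact hl (hp (l - 1) (by omega) (by omega))
    subst hli
    have hjr : j ≤ r := by
      by_contra hcon
      exact hr (hp r (by omega) (by omega))
    exact ⟨rfl, hS' l le_rfl hlr.le, hS' j hij.le hjr⟩
  unfold isClosedComp closedIn
  split_ifs with hc
  · have hempty : starts F S ∩ Set.Icc i j = ∅ := Set.subset_empty_iff.mp fun l hl => by
      obtain ⟨-, h1, h2⟩ := hsub hl
      exact hc.elim h1 h2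
    rw [hempty, Set.ncard_empty]
  · rw [← Set.ncard_singleton i]
    exact Set.ncard_le_ncard (fun l hl => (hsub hl).1)

lemma Comp.icc_subset_compl {A D : Finset (Sym2 ℤ)} {S : Set ℤ} {i j : ℤ} (h : Comp A S i j)
    (hDA : D ⊆ A) (l r : ℤ) (hl : l ∈ (Set.Icc i j)ᶜ) (hD : ClosedComp D S l r) :
    Set.Icc l r ⊆ (Set.Icc i j)ᶜ := by
  rintro m ⟨hlm, hmr⟩ ⟨him, hmj⟩
  obtain ⟨hlr, hp, hS, -, -⟩ := hD
  have hli : l < i := by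
    by_contra hcon
    exact hl ⟨by omega, by omega⟩
  rcases h.2.2.2.1 with h1 | h1
  · exact hS i hli.le (by omega) h1
  · exact h1 (hDA (hp (i - 1) (by omega) (by omega)))

/-- A bound for the length of an interval in terms of the lengths `α` of its runs of `e`, the
lengths `β` of its gaps and the number of runs. -/
lemma length_le_of_runs {e : ℤ → Prop} {α β : ℝ} (hα0 : 0 ≤ α) (hβ0 : 0 ≤ β) {b : ℤ}
    (hb : e (b - 1) → ¬ e b) (n : ℕ) : ∀ a, a < b → b - a ≤ n → (e a → ¬ e (a - 1)) →
    (∀ l r, a ≤ l → l < r → r ≤ b → (∀ m, l ≤ m → m < r → e m) → ¬ e (l - 1) → ¬ e r →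
      ((r - l : ℤ) : ℝ) ≤ α) →
    (∀ l r, a ≤ l → l < r → r ≤ b → (∀ m, l ≤ m → m < r → ¬ e m) → (l = a ∨ e (l - 1)) →
      (r = b ∨ e r) → ((r - l : ℤ) : ℝ) ≤ β) →
    ((b - a : ℤ) : ℝ) ≤ ((Finset.Ico a b).filter fun l => e l ∧ ¬ e (l - 1)).card * (α + β) + β
      - (if e a then β else 0) - (if e (b - 1) then β else 0) := by
  induction n with
  | zero => intro a hab hn; omega
  | succ n ih =>
    intro a hab hn ha hα hβ
    by_cases hea : e a
    · obtain ⟨s, has, hsb, hs, hrun⟩ := exists_first (P := fun m => m = b ∨ ¬ e m) hab.le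
        (Or.inl rfl)
      have hrun' : ∀ m, a ≤ m → m < s → e m := fun m h1 h2 => by
        have := hrun m h1 h2
        tauto
      have hlt : a < s := by
        rcases eq_or_lt_of_le has with rfl | h
        · rcases hs with h | h
          · omega
          · exact absurd hea h
        · exact h
      have hns : ¬ e s := by
        rcases hs with rfl | h
        · exact hb (hrun' _ (by omega) (by omega))
        · exact h
      have h1 := hα a s le_rfl hlt hsb hrun' (ha hea) hns
      have hmem : a ∈ (Finset.Ico a b).filter fun l => e l ∧ ¬ e (l - 1) :=
        Finset.mem_filter.mpr ⟨Finset.mem_Ico.mpr ⟨le_rfl, hab⟩, hea, ha hea⟩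
      rcases eq_or_lt_of_le hsb with rfl | hsb'
      · have hcard : (1 : ℝ) ≤ ((Finset.Ico a s).filter fun l => e l ∧ ¬ e (l - 1)).card := by
          exact_mod_cast Finset.card_pos.mpr ⟨a, hmem⟩
        rw [if_pos hea, if_pos (hrun' _ (by omega) (by omega))]
        nlinarith
      · have h2 := ih s hsb' (by push_cast at hn ⊢; omega) (fun h => absurd h hns)
          (fun l r k1 k2 k3 => hα l r (by omega) k2 k3)
          (fun l r k1 k2 k3 k4 k5 => hβ l r (by omega) k2 k3 k4 (Or.inr (by
            rcases k5 with rfl | k5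
            · exact hrun' _ (by omega) (by omega)
            · exact k5)))
        have hcard : ((Finset.Ico s b).filter fun l => e l ∧ ¬ e (l - 1)).card + 1 ≤
            ((Finset.Ico a b).filter fun l => e l ∧ ¬ e (l - 1)).card := by
          rw [← Finset.card_insert_of_notMem (a := a) (by simp; omega)]
          refine Finset.card_le_card (Finset.insert_subset hmem
            (Finset.filter_subset_filter _ (Finset.Ico_subset_Ico_left has)))
        have hcard' : (((Finset.Ico s b).filter fun l => e l ∧ ¬ e (l - 1)).card : ℝ) + 1 ≤
            ((Finset.Ico a b).filter fun l => e l ∧ ¬ e (l - 1)).card := by exact_mod_cast hcard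
        rw [if_neg hns] at h2
        rw [if_pos hea]
        push_cast at h1 h2 ⊢
        nlinarith
    · obtain ⟨s, has, hsb, hs, hrun⟩ := exists_first (P := fun m => m = b ∨ e m) hab.le
        (Or.inl rfl)
      have hrun' : ∀ m, a ≤ m → m < s → ¬ e m := fun m h1 h2 => by
        have := hrun m h1 h2
        tauto
      have hlt : a < s := by
        rcases eq_or_lt_of_le has with rfl | h
        · rcases hs with h | h
          · omega
          · exact absurd h hea
        · exact h
      have h1 := hβ a s le_rfl hlt hsb hrun' (Or.inl rfl) hs
      rcases eq_or_lt_of_le hsb with rfl | hsb'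
      · rw [if_neg hea, if_neg (hrun' _ (by omega) (by omega))]
        have : (0 : ℝ) ≤ ((Finset.Ico a s).filter fun l => e l ∧ ¬ e (l - 1)).card := by
          positivity
        nlinarith
      · have hes : e s := hs.resolve_left (by omega)
        have h2 := ih s hsb' (by push_cast at hn ⊢; omega)
          (fun _ => hrun' _ (by omega) (by omega))
          (fun l r k1 k2 k3 => hα l r (by omega) k2 k3)
          (fun l r k1 k2 k3 k4 k5 => hβ l r (by omega) k2 k3 k4 (Or.inr (by
            rcases k5 with rfl | k5
            · exact absurd hes (k4 _ le_rfl k2)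
            · exact k5)))
        have hcard' : (((Finset.Ico s b).filter fun l => e l ∧ ¬ e (l - 1)).card : ℝ) ≤
            ((Finset.Ico a b).filter fun l => e l ∧ ¬ e (l - 1)).card := by
          exact_mod_cast Finset.card_le_card
            (Finset.filter_subset_filter _ (Finset.Ico_subset_Ico_left has))
        rw [if_pos hes] at h2
        rw [if_neg hea]
        push_cast at h1 h2 ⊢
        nlinarith

/-- Cutting off the parts of `E` attached to the endpoints in `S` of a component `(x, y)` of
`D|S`, where `D` is the union of `E` and `F`, leaves an interval `(p, q)` whose length is bounded
in terms of the number of closed components of `E|S`, their lengths and the gaps. -/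
lemma Comp.exists_trim {D E F : Finset (Sym2 ℤ)} {S : Set ℤ} {x y : ℤ} (h : Comp D S x y)
    (hE : (E : Set (Sym2 ℤ)) ⊆ EPinf) (hED : E ⊆ D) (hFD : F ⊆ D)
    (hD : ∀ m, HasEdge D m → HasEdge E m ∨ HasEdge F m) (hnot : ¬ pathIn E x y) {α β : ℝ}
    (hα0 : 0 ≤ α) (hβ0 : 0 ≤ β)
    (hα : ∀ l r, x ≤ l → r ≤ y → l ∉ S → r ∉ S → Comp E S l r → ((r - l : ℤ) : ℝ) ≤ α)
    (hβ : ∀ l r, x ≤ l → r ≤ y → Comp F (S ∪ vset E) l r → ((r - l : ℤ) : ℝ) ≤ β) :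
    ∃ p q, x ≤ p ∧ p < q ∧ q ≤ y ∧
      (p = x ∨ (x ∈ S ∧ p ∉ S ∧ Comp E S x p)) ∧ (q = y ∨ (y ∈ S ∧ q ∉ S ∧ Comp E S q y)) ∧
      (∀ m, p ≤ m → m < q → HasEdge E m → 1 ≤ closedIn E S (Set.Icc x y)) ∧
      ((q - p : ℤ) : ℝ) ≤ closedIn E S (Set.Icc x y) * (α + β) + β ∧
      (x ∉ S → HasEdge E x → ((q - p : ℤ) : ℝ) ≤ closedIn E S (Set.Icc x y) * (α + β)) ∧
      (y ∉ S → HasEdge E (y - 1) →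
        ((q - p : ℤ) : ℝ) ≤ closedIn E S (Set.Icc x y) * (α + β)) := by
  obtain ⟨hxy, hpath, hint, hx, hy⟩ := h
  have hxE : x ∈ S ∨ ¬ HasEdge E (x - 1) := hx.imp_right fun h h' => h (hED h')
  have hyE : y ∈ S ∨ ¬ HasEdge E y := hy.imp_right fun h h' => h (hED h')
  obtain ⟨m₀, hm1, hm2, hm3⟩ : ∃ m, x ≤ m ∧ m < y ∧ ¬ HasEdge E m := by
    by_contra hcon
    push Not at hcon
    exact hnot hcon
  obtain ⟨p, hxp, hpm, hxS, hp⟩ : ∃ p, x ≤ p ∧ p ≤ m₀ ∧ (x ∈ S → ¬ HasEdge E p) ∧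
      (p = x ∨ (x ∈ S ∧ p ∉ S ∧ Comp E S x p)) := by
    by_cases hxS : x ∈ S
    · obtain ⟨p, hxp, hpm, hp, hrun⟩ := exists_first (P := fun m => ¬ HasEdge E m) hm1 hm3
      refine ⟨p, hxp, hpm, fun _ => hp, ?_⟩
      rcases eq_or_lt_of_le hxp with rfl | hlt
      · exact Or.inl rfl
      · exact Or.inr ⟨hxS, hint p hlt (by omega), hlt, fun m h1 h2 => not_not.mp (hrun m h1 h2),
          fun m h1 h2 => hint m h1 (by omega), Or.inl hxS, Or.inr hp⟩
    · exact ⟨x, le_rfl, hm1, fun h => absurd h hxS, Or.inl rfl⟩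
  obtain ⟨q, hqm, hqy, hyS, hq⟩ : ∃ q, m₀ < q ∧ q ≤ y ∧ (y ∈ S → ¬ HasEdge E (q - 1)) ∧
      (q = y ∨ (y ∈ S ∧ q ∉ S ∧ Comp E S q y)) := by
    by_cases hyS : y ∈ S
    · obtain ⟨k, hmk, hky, hk, hrun⟩ := exists_last (P := fun m => ¬ HasEdge E m)
        (show m₀ ≤ y - 1 by omega) hm3
      refine ⟨k + 1, by omega, by omega, fun _ => by rwa [add_sub_cancel_right], ?_⟩
      rcases eq_or_lt_of_le (show k + 1 ≤ y by omega) with h | hlt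
      · exact Or.inl h
      · refine Or.inr ⟨hyS, hint (k + 1) (by omega) hlt, hlt, fun m h1 h2 =>
          not_not.mp (hrun m (by omega) (by omega)), fun m h1 h2 => hint m (by omega) h2,
          Or.inr (by rwa [add_sub_cancel_right]), Or.inl hyS⟩
    · exact ⟨y, by omega, le_rfl, fun h => absurd h hyS, Or.inl rfl⟩
  have hpE : HasEdge E p → ¬ HasEdge E (p - 1) := by
    intro h
    rcases hp with rfl | ⟨h1, -⟩
    · exact hxE.resolve_left fun h' => hxS h' h
    · exact absurd h (hxS h1)
  have hqE : HasEdge E (q - 1) → ¬ HasEdge E q := by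
    intro h
    rcases hq with rfl | ⟨h1, -⟩
    · exact hyE.resolve_left fun h' => hyS h' h
    · exact absurd h (hyS h1)
  have hclosed : ∀ l r, p ≤ l → l < r → r ≤ q → (∀ m, l ≤ m → m < r → HasEdge E m) →
      ∀ m, l ≤ m → m ≤ r → m ∉ S := by
    intro l r h1 h2 h3 h4 m h5 h6 hm
    by_cases hmx : m = x
    · subst hmx
      obtain rfl : l = m := by omega
      obtain rfl : p = l := by omega
      exact hxS hm (h4 _ le_rfl h2)
    by_cases hmy : m = y
    · subst hmy
      obtain rfl : r = m := by omega
      obtain rfl : q = r := by omega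
      exact hyS hm (h4 _ (by omega) (by omega))
    · exact hint m (by omega) (by omega) hm
  have hstart : ∀ l, p ≤ l → l < q → HasEdge E l → ¬ HasEdge E (l - 1) →
      l ∈ starts E S ∩ Set.Icc x y := by
    intro l h1 h2 h3 h4
    obtain ⟨r, hlr, hrun, hr⟩ := exists_run_end h3
    have hrq : r ≤ q := by
      by_contra hcon
      exact hqE (hrun _ (by omega) (by omega)) (hrun _ (by omega) (by omega))
    exact ⟨⟨r, hlr, hrun, hclosed l r h1 hlr hrq hrun, (edge_sub_one E l).not.mpr h4, hr⟩,
      by omega, by omega⟩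
  have hcard : (((Finset.Ico p q).filter fun l => HasEdge E l ∧ ¬ HasEdge E (l - 1)).card : ℝ) ≤
      closedIn E S (Set.Icc x y) := by
    rw [← Set.ncard_coe_finset]
    refine Nat.cast_le.mpr (Set.ncard_le_ncard ?_ ((finite_starts E S).inter_of_left _))
    intro l hl
    simp only [Finset.coe_filter, Finset.mem_Ico, Set.mem_ofPred_eq] at hl
    exact hstart l hl.1.1 hl.1.2 hl.2.1 hl.2.2
  have hlen := length_le_of_runs (e := HasEdge E) hα0 hβ0 hqE (q - p).toNat p (by omega)
    (by omega) hpE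
    (fun l r h1 h2 h3 h4 h5 h6 => by
      have hc := hclosed l r h1 h2 h3 h4
      exact hα l r (by omega) (by omega) (hc l le_rfl h2.le) (hc r h2.le le_rfl)
        ⟨h2, h4, fun m k1 k2 => hc m k1.le k2.le, Or.inr h5, Or.inr h6⟩)
    (fun l r h1 h2 h3 h4 h5 h6 => by
      refine hβ l r (by omega) (by omega) ⟨h2, fun m k1 k2 => (hD m (hpath m (by omega)
        (by omega))).resolve_left (h4 m k1 k2), ?_, ?_, ?_⟩
      · rintro m k1 k2 (k3 | k3)
        · exact hint m (by omega) (by omega) k3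
        · rw [mem_vset_iff hE] at k3
          rcases k3 with k3 | k3
          · exact h4 _ (by omega) (by omega) k3
          · exact h4 _ k1.le k2 k3
      · rcases h5 with rfl | h5
        · rcases hp with rfl | ⟨-, -, hp⟩
          · exact hx.imp Or.inl fun h h' => h (hFD h')
          · exact Or.inl (Or.inr ((mem_vset_iff hE l).mpr (Or.inl
              (hp.2.1 (l - 1) (by have := hp.1; omega) (by omega)))))
        · exact Or.inl (Or.inr ((mem_vset_iff hE l).mpr (Or.inl h5)))
      · rcases h6 with rfl | h6
        · rcases hq with rfl | ⟨-, -, hq⟩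
          · exact hy.imp Or.inl fun h h' => h (hFD h')
          · exact Or.inl (Or.inr ((mem_vset_iff hE r).mpr (Or.inr
              (hq.2.1 r le_rfl hq.1))))
        · exact Or.inl (Or.inr ((mem_vset_iff hE r).mpr (Or.inr h6))))
  have hle : (((Finset.Ico p q).filter fun l => HasEdge E l ∧ ¬ HasEdge E (l - 1)).card : ℝ) *
      (α + β) ≤ closedIn E S (Set.Icc x y) * (α + β) :=
    mul_le_mul_of_nonneg_right hcard (by linarith)
  refine ⟨p, q, hxp, by omega, hqy, hp, hq, fun m h1 h2 h3 => ?_, ?_, fun h1 h2 => ?_,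
    fun h1 h2 => ?_⟩
  · obtain ⟨l, hpl, hlm, hl, hrun⟩ : ∃ l, p ≤ l ∧ l ≤ m ∧ HasEdge E l ∧ ¬ HasEdge E (l - 1) := by
      obtain ⟨l, hpl, hlm, hl, hrun⟩ := exists_first
        (P := fun l => ∀ k, l ≤ k → k ≤ m → HasEdge E k) h1
        (fun k k1 k2 => by rwa [show k = m by omega])
      have hel := hl l le_rfl hlm
      refine ⟨l, hpl, hlm, hel, fun h => ?_⟩
      rcases eq_or_lt_of_le hpl with rfl | hlt
      · exact hpE hel h
      · refine hrun (l - 1) (by omega) (by omega) fun k k1 k2 => ?_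
        by_cases hk : k = l - 1
        · rwa [hk]
        · exact hl k (by omega) k2
    exact (Set.ncard_pos ((finite_starts E S).inter_of_left _)).mpr
      ⟨l, hstart l hpl (by omega) hl hrun⟩
  · have h3 : 0 ≤ if HasEdge E p then β else 0 := by split_ifs <;> simp [hβ0]
    have h4 : 0 ≤ if HasEdge E (q - 1) then β else 0 := by split_ifs <;> simp [hβ0]
    linarith
  · obtain rfl : p = x := hp.resolve_right fun h => h1 h.1
    rw [if_pos h2] at hlen
    have h4 : 0 ≤ if HasEdge E (q - 1) then β else 0 := by split_ifs <;> simp [hβ0]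
    linarith
  · obtain rfl : q = y := hq.resolve_right fun h => h1 h.1
    rw [if_pos h2] at hlen
    have h4 : 0 ≤ if HasEdge E p then β else 0 := by split_ifs <;> simp [hβ0]
    linarith

/-- The lower bound on the potential of `A` given by each component of `Gr(A)|S`. -/
def Bound (g : JoinTree ℤ → Set ℤ → ℝ) (c δ : ℝ) (A : JoinTree ℤ) : Prop :=
  ∀ (S : Set ℤ) (i j : ℤ), Comp A.graph S i j →
    Real.logb c (weight δ S i j * ((j - i : ℤ) : ℝ)) + closedIn A.graph S (Set.Icc i j)ᶜ ≤ g A S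

lemma mul_pow_lt_of_logb_lt {c x y : ℝ} {n k : ℕ} (hc : 1 < c) (hx : 0 < x) (hy : 0 < y)
    (h : Real.logb c x + n < Real.logb c y + k) : x * c ^ n < y * c ^ k := by
  have hc0 : 0 < c := by linarith
  rw [← Real.logb_lt_logb_iff hc (by positivity) (by positivity),
    Real.logb_mul hx.ne' (by positivity), Real.logb_mul hy.ne' (by positivity),
    Real.logb_pow, Real.logb_pow, Real.logb_self_eq_one hc]
  linarith

lemma mul_nat_le_pow {c : ℝ} (hc : 2 ≤ c) {d : ℕ} (hd : 1 ≤ d) : c * d ≤ c ^ d := by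
  induction d, hd using Nat.le_induction with
  | base => simp
  | succ n hn ih =>
    have hn' : (1 : ℝ) ≤ n := by exact_mod_cast hn
    rw [pow_succ]
    push_cast
    nlinarith [mul_le_mul_of_nonneg_right ih (show (0 : ℝ) ≤ c by linarith),
      mul_nonneg (show (0 : ℝ) ≤ c * n by positivity) (show 0 ≤ c - 2 by linarith),
      mul_nonneg (show (0 : ℝ) ≤ c by linarith) (show (0 : ℝ) ≤ n - 1 by linarith)]

lemma sq_mul_nat_le_two_mul_pow {c : ℝ} (hc : 2 ≤ c) {d : ℕ} (hd : 2 ≤ d) :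
    c ^ 2 * d ≤ 2 * c ^ d := by
  induction d, hd using Nat.le_induction with
  | base => push_cast; linarith
  | succ n hn ih =>
    have hn' : (2 : ℝ) ≤ n := by exact_mod_cast hn
    have hcn : (0 : ℝ) ≤ c ^ 2 * n := by positivity
    rw [pow_succ c n]
    push_cast
    nlinarith [mul_le_mul_of_nonneg_right ih (show (0 : ℝ) ≤ c by linarith),
      mul_nonneg (sq_nonneg c) (show (0 : ℝ) ≤ n - 1 by linarith)]

lemma pathIn_leaf {l : Option (Sym2 ℤ)} {i j : ℤ} (hij : i < j)
    (h : pathIn (graph (leaf l)) i j) : j = i + 1 := by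
  by_contra hne
  have h1 := h i le_rfl hij
  have h2 := h (i + 1) (by omega) (by omega)
  cases l with
  | none => simp [graph] at h1
  | some e =>
    simp only [graph, Finset.mem_singleton] at h1 h2
    have := edge_injective (h1.trans h2.symm)
    omega

section LowerBound

variable {g : JoinTree ℤ → Set ℤ → ℝ} {c δ : ℝ} {A : JoinTree ℤ} {S : Set ℤ} {i j : ℤ}

lemma closedIn_add_compl (F : Finset (Sym2 ℤ)) (S T K : Set ℤ) :
    closedIn F S K + closedIn F S Kᶜ = closedIn F S T + closedIn F S Tᶜ := by
  unfold closedIn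
  have h1 := Set.ncard_inter_add_ncard_sdiff_eq_ncard (starts F S) K (finite_starts F S)
  have h2 := Set.ncard_inter_add_ncard_sdiff_eq_ncard (starts F S) T (finite_starts F S)
  rw [Set.sdiff_eq] at h1 h2
  omega

/-- The potential of `A` is at least the bound coming from a component of a sub-join-tree. -/
lemma Phi2Ok.lt_of_desc (hg : Phi2Ok EPinf theta1 g) (hc : 1 < c) (hδ0 : 0 < δ)
    (hA : Over EPinf A) (hK : Comp A.graph S i j) {E : JoinTree ℤ} (hE : Desc E A)
    (hbound : Bound g c δ E) {Y : ℝ} (hY : 0 < Y)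
    (hlt : g A S < Real.logb c Y + closedIn A.graph S (Set.Icc i j)ᶜ) {a b : ℤ}
    (hab : Comp E.graph S a b) :
    weight δ S a b * ((b - a : ℤ) : ℝ) * c ^ closedIn E.graph S (Set.Icc i j) <
      Y * c ^ isClosedComp S a b := by
  have hlen : (0 : ℝ) < ((b - a : ℤ) : ℝ) := by exact_mod_cast sub_pos.mpr hab.1
  refine mul_pow_lt_of_logb_lt hc (mul_pos (weight_pos hδ0 S a b) hlen) hY ?_
  have h1 := hbound S a b hab
  have h2 := hg.desc_le hE hA S
  have h3 : closedIn A.graph S (Set.Icc i j)ᶜ ≤ closedIn E.graph S (Set.Icc i j)ᶜ +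
      closedIn A.graph (S ∪ vset E.graph) (Set.Icc i j)ᶜ :=
    closedIn_le_add (hA.desc hE) hE.graph_subset subset_rfl (fun _ h => Or.inr h)
      (hK.icc_subset_compl subset_rfl)
  have h4 := closedIn_mono A.graph (S ∪ vset E.graph) (Set.subset_univ (Set.Icc i j)ᶜ)
  have h5 := closedIn_add_compl E.graph S (Set.Icc a b) (Set.Icc i j)
  have h6 := hab.closedIn_le
  have h7 : (closedIn E.graph S (Set.Icc i j) : ℝ) + closedIn A.graph S (Set.Icc i j)ᶜ ≤
      isClosedComp S a b + closedIn E.graph S (Set.Icc a b)ᶜ +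
        closedIn A.graph (S ∪ vset E.graph) Set.univ := by
    exact_mod_cast (by omega : closedIn E.graph S (Set.Icc i j) +
      closedIn A.graph S (Set.Icc i j)ᶜ ≤ isClosedComp S a b + closedIn E.graph S (Set.Icc a b)ᶜ +
        closedIn A.graph (S ∪ vset E.graph) Set.univ)
  linarith

/-- The potential of `A` is at least the bound coming from a gap left by a child `E` of a
sub-join-tree in the other child `F`. -/
lemma Phi2Ok.lt_of_gap (hg : Phi2Ok EPinf theta1 g) (hc : 1 < c) (hδ0 : 0 < δ)
    (hA : Over EPinf A) (hK : Comp A.graph S i j) {D E F : JoinTree ℤ} (hD : Desc D A)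
    (hch : HasChildren D E F) (hbound : Bound g c δ F) {Y : ℝ} (hY : 0 < Y)
    (hlt : g A S < Real.logb c Y + closedIn A.graph S (Set.Icc i j)ᶜ) {a b : ℤ} (hia : i ≤ a)
    (hbj : b ≤ j) (hab : Comp F.graph (S ∪ vset E.graph) a b) :
    weight δ (S ∪ vset E.graph) a b * ((b - a : ℤ) : ℝ) * c ^ closedIn E.graph S (Set.Icc i j) <
      Y := by
  have hlen : (0 : ℝ) < ((b - a : ℤ) : ℝ) := by exact_mod_cast sub_pos.mpr hab.1
  rw [← mul_one Y, ← pow_zero c]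
  refine mul_pow_lt_of_logb_lt hc (mul_pos (weight_pos hδ0 _ a b) hlen) hY ?_
  have hDA := hA.desc hD
  have h1 := hbound _ a b hab
  have h2 := hg.desc_le hD hA S
  have h3 := hg.inverted_dagger hch hDA S
  have h4 : closedIn A.graph S (Set.Icc i j)ᶜ ≤ closedIn D.graph S (Set.Icc i j)ᶜ +
      closedIn A.graph (S ∪ vset D.graph) (Set.Icc i j)ᶜ :=
    closedIn_le_add hDA hD.graph_subset subset_rfl (fun _ h => Or.inr h)
      (hK.icc_subset_compl subset_rfl)
  have h5 := hch.closedIn_le hDA (hK.icc_subset_compl hD.graph_subset)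
  have h6 := closedIn_mono A.graph (S ∪ vset D.graph) (Set.subset_univ (Set.Icc i j)ᶜ)
  have h7 := closedIn_mono F.graph (S ∪ vset E.graph)
    (Set.compl_subset_compl.mpr (Set.Icc_subset_Icc hia hbj))
  have h8 := closedIn_add_compl E.graph S Set.univ (Set.Icc i j)
  have h9 : closedIn E.graph S Set.univᶜ = 0 := by simp [closedIn]
  have h10 : (closedIn E.graph S (Set.Icc i j) : ℝ) + closedIn A.graph S (Set.Icc i j)ᶜ ≤
      closedIn E.graph S Set.univ + closedIn F.graph (S ∪ vset E.graph) (Set.Icc a b)ᶜ +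
        closedIn A.graph (S ∪ vset D.graph) Set.univ := by
    exact_mod_cast (by omega : closedIn E.graph S (Set.Icc i j) +
      closedIn A.graph S (Set.Icc i j)ᶜ ≤ closedIn E.graph S Set.univ +
        closedIn F.graph (S ∪ vset E.graph) (Set.Icc a b)ᶜ +
        closedIn A.graph (S ∪ vset D.graph) Set.univ)
  rw [Nat.cast_zero]
  linarith

/-- If the potential of `A` is too small, the lengths of the pieces into which a child `E` cuts a
component of a sub-join-tree are bounded. -/
lemma Phi2Ok.exists_trim (hg : Phi2Ok EPinf theta1 g) (hc : 7 < c) (hδ : c * δ = c - 3)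
    (hA : Over EPinf A) (hK : Comp A.graph S i j) {D E F : JoinTree ℤ} (hD : Desc D A)
    (hch : HasChildren D E F) (hE : Bound g c δ E) (hF : Bound g c δ F) {Y : ℝ} (hY : 0 < Y)
    (hlt : g A S < Real.logb c Y + closedIn A.graph S (Set.Icc i j)ᶜ) {x y : ℤ} (hix : i ≤ x)
    (hyj : y ≤ j) (hxy : Comp D.graph S x y) (hnot : ¬ pathIn E.graph x y) :
    ∃ (d : ℕ) (π : ℝ) (p q : ℤ), d = closedIn E.graph S (Set.Icc i j) ∧ 0 < π ∧
      π * c ^ d * δ = Y ∧ x ≤ p ∧ p < q ∧ q ≤ y ∧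
      (p = x ∨ (x ∈ S ∧ ((p - x : ℤ) : ℝ) < π)) ∧ (q = y ∨ (y ∈ S ∧ ((y - q : ℤ) : ℝ) < π)) ∧
      (∀ m, p ≤ m → m < q → HasEdge E.graph m → 1 ≤ d) ∧
      ((q - p : ℤ) : ℝ) ≤ d * ((c - 1) * π) + 2 * π ∧
      (x ∉ S → HasEdge E.graph x → ((q - p : ℤ) : ℝ) ≤ d * ((c - 1) * π)) ∧
      (y ∉ S → HasEdge E.graph (y - 1) → ((q - p : ℤ) : ℝ) ≤ d * ((c - 1) * π)) := by
  have hc1 : 1 < c := by linarith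
  have hc0 : 0 < c := by linarith
  have hδ0 : 0 < δ := by
    by_contra hcon
    nlinarith
  have hδ1 : δ < 1 := by
    by_contra hcon
    nlinarith
  set d := closedIn E.graph S (Set.Icc i j) with hd
  have hcd : 0 < c ^ d := by positivity
  set π := Y / (c ^ d * δ) with hπ
  have hπ0 : 0 < π := by positivity
  have hπY : π * c ^ d * δ = Y := by
    rw [hπ]
    field_simp
  have hmono : (closedIn E.graph S (Set.Icc x y) : ℝ) ≤ d :=
    Nat.cast_le.mpr (closedIn_mono _ _ (Set.Icc_subset_Icc hix hyj))
  have hdesc := hch.desc.trans hD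
  have hsum : c * δ * π + 2 * π = (c - 1) * π := by rw [hδ]; ring
  obtain ⟨p, q, h1, h2, h3, h4, h5, h6, h7, h8, h9⟩ := hxy.exists_trim
    (hA.desc hdesc) hch.desc.graph_subset hch.swap.desc.graph_subset (fun _ => hch.hasEdge) hnot
    (α := c * δ * π) (β := 2 * π) (by positivity) (by positivity)
    (fun l r k1 k2 k3 k4 k5 => by
      have := hg.lt_of_desc hc1 hδ0 hA hK hdesc hE hY hlt k5
      rw [weight, isClosedComp, if_neg k3, if_neg k4, if_neg (by tauto), ← hd, ← hπY, one_mul,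
        pow_one, show π * c ^ d * δ * c = c * δ * π * c ^ d by ring] at this
      exact (lt_of_mul_lt_mul_right this hcd.le).le)
    (fun l r k1 k2 k3 => by
      have h := hg.lt_of_gap hc1 hδ0 hA hK hD hch hF hY hlt (hix.trans k1) (k2.trans hyj) k3
      have hlen : (0 : ℝ) < ((r - l : ℤ) : ℝ) := by exact_mod_cast sub_pos.mpr k3.1
      have h' : δ / 2 * ((r - l : ℤ) : ℝ) * c ^ d < Y := lt_of_le_of_lt
        (mul_le_mul_of_nonneg_right (mul_le_mul_of_nonneg_right
          (half_le_weight hδ0 hδ1 _ l r) hlen.le) hcd.le) h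
      rw [← hπY] at h'
      have h'' : ((r - l : ℤ) : ℝ) * (δ / 2 * c ^ d) < 2 * π * (δ / 2 * c ^ d) := by
        linarith
      exact (lt_of_mul_lt_mul_right h'' (by positivity)).le)
  refine ⟨d, π, p, q, rfl, hπ0, hπY, h1, h2, h3, ?_, ?_, fun m k1 k2 k3 => ?_, ?_, fun k1 k2 => ?_,
    fun k1 k2 => ?_⟩
  · refine h4.imp_right ?_
    rintro ⟨k1, k2, k3⟩
    refine ⟨k1, ?_⟩
    have := hg.lt_of_desc hc1 hδ0 hA hK hdesc hE hY hlt k3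
    rw [weight, isClosedComp, if_pos k1, if_neg k2, if_pos (Or.inl k1), ← hd, ← hπY, pow_zero,
      mul_one, show π * c ^ d * δ = δ * π * c ^ d by ring] at this
    exact lt_of_mul_lt_mul_left (lt_of_mul_lt_mul_right this hcd.le) hδ0.le
  · refine h5.imp_right ?_
    rintro ⟨k1, k2, k3⟩
    refine ⟨k1, ?_⟩
    have := hg.lt_of_desc hc1 hδ0 hA hK hdesc hE hY hlt k3
    rw [weight, isClosedComp, if_neg k2, if_pos k1, if_pos (Or.inr k1), ← hd, ← hπY, pow_zero,
      mul_one, show π * c ^ d * δ = δ * π * c ^ d by ring] at this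
    exact lt_of_mul_lt_mul_left (lt_of_mul_lt_mul_right this hcd.le) hδ0.le
  · exact (h6 m k1 k2 k3).trans (closedIn_mono _ _ (Set.Icc_subset_Icc hix hyj))
  · rw [hsum] at h7
    have := mul_le_mul_of_nonneg_right hmono (show 0 ≤ (c - 1) * π by nlinarith)
    linarith
  · have h := h8 k1 k2
    rw [hsum] at h
    exact h.trans (mul_le_mul_of_nonneg_right hmono (by nlinarith))
  · have h := h9 k1 k2
    rw [hsum] at h
    exact h.trans (mul_le_mul_of_nonneg_right hmono (by nlinarith))

lemma Phi2Ok.bound_of_length_one (hg : Phi2Ok EPinf theta1 g) (hc : 7 < c) (hδ : c * δ = c - 3)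
    (hA : Over EPinf A) (hij : j = i + 1) :
    Real.logb c (weight δ S i j * ((j - i : ℤ) : ℝ)) + closedIn A.graph S (Set.Icc i j)ᶜ ≤
      g A S := by
  have hδ0 : 0 < δ := by
    by_contra hcon
    nlinarith
  have hδ1 : δ < 1 := by
    by_contra hcon
    nlinarith
  have h1 := hg.closedIn_le hA S
  have h2 : (closedIn A.graph S (Set.Icc i j)ᶜ : ℝ) ≤ closedIn A.graph S Set.univ :=
    Nat.cast_le.mpr (closedIn_mono _ _ (Set.subset_univ _))
  have h3 : Real.logb c (weight δ S i j * ((j - i : ℤ) : ℝ)) ≤ 0 := by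
    rw [hij, add_sub_cancel_left, Int.cast_one, mul_one]
    exact Real.logb_nonpos (by linarith) (weight_pos hδ0 _ _ _).le (weight_le_one hδ0 hδ1 _ _ _)
  linarith

/-- The bound for half-open and open components. -/
lemma Phi2Ok.bound_of_not_closed (hg : Phi2Ok EPinf theta1 g) (hc : 7 < c)
    (hδ : c * δ = c - 3) (hA : Over EPinf A)
    (ih : ∀ E : JoinTree ℤ, sizeOf E < sizeOf A → Over EPinf E → Bound g c δ E)
    (hK : Comp A.graph S i j) (hS : i ∈ S ∨ j ∈ S) :
    Real.logb c (weight δ S i j * ((j - i : ℤ) : ℝ)) + closedIn A.graph S (Set.Icc i j)ᶜ ≤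
      g A S := by
  obtain ⟨B, C, rfl⟩ | hij : (∃ B C, A = node B C) ∨ j = i + 1 := by
    cases A with
    | leaf l => exact Or.inr (pathIn_leaf hK.1 hK.2.1)
    | node B C => exact Or.inl ⟨B, C, rfl⟩
  swap
  · exact hg.bound_of_length_one hc hδ hA hij
  set A := node B C with hAdef
  by_contra hcon
  push Not at hcon
  have hδ0 : 0 < δ := by
    by_contra hcon
    nlinarith
  have hc1 : 1 < c := by linarith
  have hlen : (0 : ℝ) < ((j - i : ℤ) : ℝ) := by exact_mod_cast sub_pos.mpr hK.1
  have hY : 0 < weight δ S i j * ((j - i : ℤ) : ℝ) := mul_pos (weight_pos hδ0 S i j) hlen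
  have hchild : ∀ m, HasEdge A.graph m → ∃ E F, HasChildren A E F ∧ HasEdge E.graph m := by
    intro m hm
    have hch : HasChildren A B C := Or.inl rfl
    rcases hch.hasEdge hm with h | h
    · exact ⟨B, C, hch, h⟩
    · exact ⟨C, B, hch.swap, h⟩
  have htrim : ∀ {E F : JoinTree ℤ} (hch : HasChildren A E F), _ := fun {E F} hch =>
    hg.exists_trim hc hδ hA hK (Desc.refl A) hch (ih E hch.sizeOf_lt (hA.desc hch.desc))
      (ih F hch.swap.sizeOf_lt (hA.desc hch.swap.desc)) hY hcon le_rfl le_rfl hK (by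
        intro hpath
        have hsub := hch.desc.graph_subset
        have := hg.lt_of_desc hc1 hδ0 hA hK hch.desc (ih E hch.sizeOf_lt (hA.desc hch.desc)) hY
          hcon ⟨hK.1, hpath, hK.2.2.1, hK.2.2.2.1.imp_right fun h h' => h (hsub h'),
            hK.2.2.2.2.imp_right fun h h' => h (hsub h')⟩
        rw [isClosedComp, if_pos hS, pow_zero, mul_one] at this
        nlinarith [one_le_pow₀ hc1.le (n := closedIn E.graph S (Set.Icc i j))])
  by_cases hopen : i ∈ S ∧ j ∈ S
  · have hmid : i ≤ i + (j - i) / 2 ∧ i + (j - i) / 2 < j := by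
      have := hK.1
      omega
    obtain ⟨E, F, hch, hEm⟩ := hchild (i + (j - i) / 2) (hK.2.1 _ hmid.1 hmid.2)
    obtain ⟨d, π, p, q, -, hπ, hπY, h1, h2, h3, h4, h5, h6, h7, -, -⟩ := htrim hch
    have hπk : 2 * (π * c ^ d) = ((j - i : ℤ) : ℝ) := by
      rw [weight, if_pos hopen.1, if_pos hopen.2] at hπY
      have : 2 * (π * c ^ d) * δ = ((j - i : ℤ) : ℝ) * δ := by linarith
      exact mul_right_cancel₀ hδ0.ne' this
    have hp : ((p - i : ℤ) : ℝ) < π := by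
      rcases h4 with rfl | h4
      · simpa using hπ
      · exact h4.2
    have hq : ((j - q : ℤ) : ℝ) < π := by
      rcases h5 with rfl | h5
      · simpa using hπ
      · exact h5.2
    have hpow : 1 ≤ c ^ d := one_le_pow₀ hc1.le
    have hlarge : π ≤ π * c ^ d := by nlinarith
    have hd : 1 ≤ d := by
      refine h6 _ ?_ ?_ hEm
      · by_contra hlt
        have h : j - i ≤ 2 * (p - i) := by omega
        have h' : ((j - i : ℤ) : ℝ) ≤ 2 * ((p - i : ℤ) : ℝ) := by exact_mod_cast h
        linarith
      · by_contra hlt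
        have h : j - i ≤ 2 * (j - q) := by omega
        have h' : ((j - i : ℤ) : ℝ) ≤ 2 * ((j - q : ℤ) : ℝ) := by exact_mod_cast h
        linarith
    have hd' : (1 : ℝ) ≤ d := by exact_mod_cast hd
    have hcd := mul_nat_le_pow (c := c) (by linarith) hd
    push_cast at *
    have h8 : 2 * (π * c ^ d) < π * (4 + d * (c - 1)) := by linarith
    have h9 : π * (4 + d * (c - 1)) ≤ π * (2 * (c * d)) :=
      mul_le_mul_of_nonneg_left (by nlinarith) hπ.le
    have h10 := mul_le_mul_of_nonneg_left hcd hπ.le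
    linarith
  · have hw : weight δ S i j = δ := by
      unfold weight
      split_ifs <;> tauto
    have hfinish : ∀ {d : ℕ} {π : ℝ}, 0 < π → π * c ^ d * δ = weight δ S i j * ((j - i : ℤ) : ℝ) →
        1 ≤ d → ((j - i : ℤ) : ℝ) < π + d * ((c - 1) * π) → False := by
      intro d π hπ hπY hd hlt
      have hπk : π * c ^ d = ((j - i : ℤ) : ℝ) := by
        rw [hw, mul_comm δ] at hπY
        exact mul_right_cancel₀ hδ0.ne' hπY
      have hd' : (1 : ℝ) ≤ d := by exact_mod_cast hd
      have hcd := mul_le_mul_of_nonneg_left (mul_nat_le_pow (c := c) (by linarith) hd) hπ.le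
      nlinarith
    have hij := hK.1
    rcases hS with hiS | hjS
    · have hjS : j ∉ S := fun h => hopen ⟨hiS, h⟩
      obtain ⟨E, F, hch, hEm⟩ := hchild (j - 1) (hK.2.1 _ (by omega) (by omega))
      obtain ⟨d, π, p, q, -, hπ, hπY, h1, h2, h3, h4, h5, h6, -, -, h7⟩ := htrim hch
      obtain rfl : q = j := h5.resolve_right fun h => hjS h.1
      refine hfinish hπ hπY (h6 (q - 1) (by omega) (by omega) hEm) ?_
      have hp : ((p - i : ℤ) : ℝ) < π := by
        rcases h4 with rfl | h4
        · simpa using hπ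
        · exact h4.2
      have := h7 hjS hEm
      push_cast at *
      linarith
    · have hiS : i ∉ S := fun h => hopen ⟨h, hjS⟩
      obtain ⟨E, F, hch, hEm⟩ := hchild i (hK.2.1 _ le_rfl hij)
      obtain ⟨d, π, p, q, -, hπ, hπY, h1, h2, h3, h4, h5, h6, -, h7, -⟩ := htrim hch
      obtain rfl : p = i := h4.resolve_right fun h => hiS h.1
      refine hfinish hπ hπY (h6 p le_rfl (by omega) hEm) ?_
      have hq : ((j - q : ℤ) : ℝ) < π := by
        rcases h5 with rfl | h5
        · simpa using hπ
        · exact h5.2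
      have := h7 hiS hEm
      push_cast at *
      linarith

lemma two_mul_logb_le {c x y z : ℝ} (hc : 1 < c) (hx : 0 < x) (hy : 0 < y) (hz : 0 < z)
    (h : z ^ 2 ≤ x * y * c) : 2 * Real.logb c z ≤ Real.logb c x + Real.logb c y + 1 := by
  have hc0 : 0 < c := by linarith
  have := Real.logb_le_logb_of_le hc (by positivity) h
  rwa [Real.logb_pow, Real.logb_mul (by positivity) hc0.ne', Real.logb_mul hx.ne' hy.ne',
    Real.logb_self_eq_one hc, Nat.cast_ofNat] at this

/-- If `A` violates the bound for a closed component, then no sub-join-tree of `A` contains an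
initial segment of the component whose length is a fixed proportion of the component. -/
lemma Phi2Ok.false_of_initial_segment (hg : Phi2Ok EPinf theta1 g) (hc : 7 < c)
    (hcq : c ^ 2 = 10 * c - 20) (hδ : c * δ = c - 3) (hA : Over EPinf A)
    (ih : ∀ E : JoinTree ℤ, sizeOf E < sizeOf A → Over EPinf E → Bound g c δ E)
    (hK : Comp A.graph S i j) (hi : i ∉ S) (hj : j ∉ S) (hne : j ≠ i + 1)
    (hlt : g A S < Real.logb c ((j - i : ℤ) : ℝ) + closedIn A.graph S (Set.Icc i j)ᶜ)
    (D : JoinTree ℤ) : Desc D A → ∀ y, y ≤ j → Comp D.graph S i y →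
      (∀ m, y ≤ m → m < j → ¬ HasEdge D.graph m) →
      (c - 6) / 2 * ((j - i : ℤ) : ℝ) ≤ ((y - i : ℤ) : ℝ) → False := by
  have hδ0 : 0 < δ := by
    by_contra hcon
    nlinarith
  have hc1 : 1 < c := by linarith
  have hc0 : 0 < c := by linarith
  have hij := hK.1
  have hk : (2 : ℝ) ≤ ((j - i : ℤ) : ℝ) := by exact_mod_cast (by omega : 2 ≤ j - i)
  have hAj : ¬ HasEdge A.graph j := hK.2.2.2.2.resolve_left hj
  have hAi : ¬ HasEdge A.graph (i - 1) := hK.2.2.2.1.resolve_left hi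
  have hKS : ∀ m, i ≤ m → m ≤ j → m ∉ S := by
    intro m h1 h2
    rcases eq_or_lt_of_le h1 with rfl | h1
    · exact hi
    rcases eq_or_lt_of_le h2 with rfl | h2
    · exact hj
    · exact hK.2.2.1 m h1 h2
  induction D with
  | leaf l =>
    intro _ y _ hy _ hlen
    rw [pathIn_leaf hy.1 hy.2.1, add_sub_cancel_left, Int.cast_one] at hlen
    nlinarith
  | node B C ihB ihC =>
    intro hD y hyj hy hDy hlen
    obtain ⟨E, F, hch, hEi, ihE⟩ : ∃ E F, HasChildren (node B C) E F ∧ HasEdge E.graph i ∧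
        (Desc E A → ∀ y, y ≤ j → Comp E.graph S i y →
          (∀ m, y ≤ m → m < j → ¬ HasEdge E.graph m) →
          (c - 6) / 2 * ((j - i : ℤ) : ℝ) ≤ ((y - i : ℤ) : ℝ) → False) := by
      have hch : HasChildren (node B C) B C := Or.inl rfl
      rcases hch.hasEdge (hy.2.1 i le_rfl hy.1) with h | h
      · exact ⟨B, C, hch, h, ihB⟩
      · exact ⟨C, B, hch.swap, h, ihC⟩
    have hEA := hch.desc.trans hD
    have hsub : E.graph ⊆ A.graph := hEA.graph_subset
    have hEj : ¬ HasEdge E.graph j := fun h => hAj (hsub h)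
    have hEi' : ¬ HasEdge E.graph (i - 1) := fun h => hAi (hsub h)
    have hEsize : sizeOf E < sizeOf A := hch.sizeOf_lt.trans_le hD.sizeOf_le
    have hFsize : sizeOf F < sizeOf A := hch.swap.sizeOf_lt.trans_le hD.sizeOf_le
    have hEB := ih E hEsize (hA.desc hEA)
    have hFB := ih F hFsize (hA.desc (hch.swap.desc.trans hD))
    by_cases hpath : pathIn E.graph i y
    · exact ihE hEA y hyj ⟨hy.1, hpath, hy.2.2.1, Or.inr hEi',
        hy.2.2.2.2.imp_right fun h h' => h (hch.desc.graph_subset h')⟩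
        (fun m h1 h2 h => hDy m h1 h2 (hch.desc.graph_subset h)) hlen
    have hiy := hy.1
    have hyS := hKS y hiy.le hyj
    have hk0 : (0 : ℝ) < ((j - i : ℤ) : ℝ) := by linarith
    obtain ⟨t, hit, ht, hEt⟩ := exists_run_end hEi
    have hty : t < y := by
      by_contra hcon
      exact hpath fun m h1 h2 => ht m h1 (by omega)
    have hEstart : ClosedComp E.graph S i t := ⟨hit, ht, fun m h1 h2 => hKS m h1 (by omega),
      (edge_sub_one _ _).not.mpr hEi', hEt⟩
    obtain ⟨d, π, p, q, hd, hπ, hπY, -, -, -, hp, hq, -, -, hlen', -⟩ := hg.exists_trim hc hδ hA hK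
      hD hch hEB hFB hk0 hlt le_rfl hyj hy hpath
    obtain rfl : p = i := hp.resolve_right fun h => hi h.1
    obtain rfl : q = y := hq.resolve_right fun h => hyS h.1
    have hlen'' := hlen' hi hEi
    have hd1 : 1 ≤ d := by
      rw [hd]
      exact (Set.ncard_pos ((finite_starts _ S).inter_of_left _)).mpr
        ⟨p, ⟨t, hEstart⟩, le_rfl, hij.le⟩
    set k : ℝ := ((j - p : ℤ) : ℝ) with hkdef
    rcases eq_or_lt_of_le hd1 with hd1 | hd2
    swap
    · have h1 := sq_mul_nat_le_two_mul_pow (c := c) (by linarith) hd2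
      have h2 : π * c ^ d * (c - 3) = c * k := by
        rw [← hδ, ← hπY]
        ring
      have h3 : c * (d * π * c * (c - 3)) ≤ c * (2 * k) := by
        nlinarith [mul_le_mul_of_nonneg_left h1 (mul_pos hπ (show 0 < c - 3 by linarith)).le]
      have h4 := le_of_mul_le_mul_left h3 hc0
      have h5 : (c - 6) / 2 * k ≤ d * ((c - 1) * π) := hlen.trans hlen''
      have h6 : (c - 6) / 2 * k * (c * (c - 3)) ≤ (c - 1) * (2 * k) := by
        nlinarith [mul_le_mul_of_nonneg_right h5 (show 0 ≤ c * (c - 3) by nlinarith),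
          mul_le_mul_of_nonneg_left h4 (show 0 ≤ c - 1 by linarith)]
      have h7 : (c - 6) / 2 * k * (c * (c - 3)) = (4 * c - 10) * k := by
        have : (c - 6) * (c * (c - 3)) = 8 * c - 20 := by
          linear_combination (c + 1) * hcq
        linear_combination k / 2 * this
      nlinarith
    have hEgap : ∀ m, t ≤ m → m < j → ¬ HasEdge E.graph m := by
      intro m h1 h2 h3
      obtain ⟨s, hts, hsm, hs, hrun⟩ := exists_last (P := fun m => ¬ HasEdge E.graph m) h1 hEt
      have hsm' : s < m := lt_of_le_of_ne hsm fun h => hs (h ▸ h3)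
      obtain ⟨r, hsr, hr, hEr⟩ := exists_run_end
        (not_not.mp (hrun (s + 1) (by omega) (by omega)))
      have hrj : r ≤ j := by
        by_contra hcon
        exact hEj (hr j (by omega) (by omega))
      have hstart : s + 1 ∈ starts E.graph S ∩ Set.Icc p j :=
        ⟨⟨r, hsr, hr, fun m h1 h2 => hKS m (by omega) (by omega),
          by rwa [edge_sub_one, add_sub_cancel_right], hEr⟩, by omega, by omega⟩
      have hstart' : p ∈ starts E.graph S ∩ Set.Icc p j := ⟨⟨t, hEstart⟩, le_rfl, hij.le⟩
      obtain ⟨a, ha⟩ := Set.ncard_eq_one.mp (hd.symm.trans hd1.symm)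
      rw [ha] at hstart hstart'
      have := hstart.trans hstart'.symm
      omega
    have htE : t ∈ vset E.graph := (mem_vset_iff (hA.desc hEA) t).mpr
      (Or.inl (ht (t - 1) (by omega) (by omega)))
    have hgapE : ∀ m, t < m → m ≤ j → m ∉ S ∪ vset E.graph := by
      rintro m h1 h2 (h3 | h3)
      · exact hKS m (by omega) h2 h3
      · rcases (mem_vset_iff (hA.desc hEA) m).mp h3 with h | h
        · exact hEgap (m - 1) (by omega) (by omega) h
        · rcases eq_or_lt_of_le h2 with rfl | h2
          · exact hEj h
          · exact hEgap m h1.le h2 h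
    have hCompE : Comp E.graph S p t := ⟨hit, ht, fun m h1 h2 => hKS m h1.le (by omega),
      Or.inr hEi', Or.inr hEt⟩
    have hCompF : Comp F.graph (S ∪ vset E.graph) t q :=
      ⟨hty, fun m h1 h2 => (hch.hasEdge (hy.2.1 m (by omega) h2)).resolve_left
        (hEgap m h1 (by omega)), fun m h1 h2 => hgapE m h1 (by omega), Or.inl (Or.inr htE),
        Or.inr fun h => hy.2.2.2.2.elim hyS fun h' => h' (hch.swap.desc.graph_subset h)⟩
    have hgap : ((q - t : ℤ) : ℝ) < (c - 7) * k := by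
      have h := hg.lt_of_gap hc1 hδ0 hA hK hD hch hFB hk0 hlt (by omega) hyj hCompF
      rw [weight, if_pos (Set.mem_union_right S htE), if_neg (hgapE q hty hyj), ← hd, ← hd1, pow_one] at h
      have h' : ((q - t : ℤ) : ℝ) * (c - 3) < k := by
        rw [← hδ]
        linarith
      have h1 : (c - 3) * (c - 7) = 1 := by linear_combination hcq
      nlinarith [mul_lt_mul_of_pos_right h' (show 0 < c - 7 by linarith)]
    have hsplit : ((q - p : ℤ) : ℝ) = ((q - t : ℤ) : ℝ) + ((t - p : ℤ) : ℝ) := by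
      push_cast
      ring
    by_cases htlen : (c - 6) / 2 * k ≤ ((t - p : ℤ) : ℝ)
    · exact ihE hEA t (by omega) hCompE hEgap htlen
    set u : ℝ := ((t - p : ℤ) : ℝ) with hu
    have hu1 : (8 - c) / 2 * k ≤ u := by linarith
    have hu2 : u ≤ (c - 6) / 2 * k := (not_le.mp htlen).le
    have huv : ((j - t : ℤ) : ℝ) = k - u := by
      rw [hkdef, hu]
      push_cast
      ring
    have hu0 : 0 < u := by
      rw [hu]
      exact_mod_cast sub_pos.mpr hit
    have hv0 : 0 < k - u := by
      rw [← huv]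
      exact_mod_cast (by omega : 0 < j - t)
    have hCompA : Comp A.graph (S ∪ vset E.graph) t j :=
      ⟨by omega, fun m h1 h2 => hK.2.1 m (by omega) h2, fun m h1 h2 => hgapE m h1 h2.le,
        Or.inl (Or.inr htE), Or.inr hAj⟩
    have hpE : p ∈ vset E.graph := (mem_vset_iff (hA.desc hEA) p).mpr (Or.inr hEi)
    have h1 := hg.2.2.2.2.2.2 A E S hA ⟨hEA.sub, fun h => absurd hEsize (by rw [h]; omega)⟩
      fun h => hi (h hpE)
    have h2 := hEB S p t hCompE
    rw [weight, if_neg hi, if_neg (hKS t (by omega) (by omega)), one_mul] at h2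
    have h3 := hg.bound_of_not_closed hc hδ hA ih hCompA (Or.inl (Or.inr htE))
    rw [weight, if_pos (Set.mem_union_right S htE), if_neg (hgapE j (by omega) le_rfl), huv] at h3
    rw [delta_eq_closedIn hA S (Set.Icc p j)] at h1
    have h4 : 1 ≤ closedIn A.graph S (Set.Icc p j) :=
      (Set.ncard_pos ((finite_starts _ S).inter_of_left _)).mpr
        ⟨p, ⟨j, hij, hK.2.1, hKS, (edge_sub_one _ _).not.mpr hAi, hAj⟩, le_rfl, hij.le⟩
    have h5 : closedIn A.graph S (Set.Icc p j)ᶜ ≤ closedIn E.graph S (Set.Icc p j)ᶜ +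
        closedIn A.graph (S ∪ vset E.graph) (Set.Icc p j)ᶜ :=
      closedIn_le_add (hA.desc hEA) hsub subset_rfl (fun _ h => Or.inr h)
        (hK.icc_subset_compl subset_rfl)
    have h6 := closedIn_mono E.graph S
      (Set.compl_subset_compl.mpr (Set.Icc_subset_Icc (le_refl p) (by omega : t ≤ j)))
    have h7 := closedIn_mono A.graph (S ∪ vset E.graph)
      (Set.compl_subset_compl.mpr (Set.Icc_subset_Icc (by omega : p ≤ t) (le_refl j)))
    have h8 : (1 : ℝ) + closedIn A.graph S (Set.Icc p j)ᶜ ≤ closedIn A.graph S (Set.Icc p j) +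
        closedIn E.graph S (Set.Icc p t)ᶜ +
        closedIn A.graph (S ∪ vset E.graph) (Set.Icc t j)ᶜ := by
      exact_mod_cast (by omega : 1 + closedIn A.graph S (Set.Icc p j)ᶜ ≤
        closedIn A.graph S (Set.Icc p j) + closedIn E.graph S (Set.Icc p t)ᶜ +
        closedIn A.graph (S ∪ vset E.graph) (Set.Icc t j)ᶜ)
    have h9 : k ^ 2 ≤ u * (δ * (k - u)) * c := by
      have h10 : u * (δ * (k - u)) * c = (c - 3) * (u * (k - u)) := by
        rw [← hδ]
        ring
      have h11 := mul_nonneg (sub_nonneg.mpr hu1) (sub_nonneg.mpr hu2)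
      have h12 : (u - (8 - c) / 2 * k) * ((c - 6) / 2 * k - u) = u * (k - u) - (c - 7) * k ^ 2 := by
        linear_combination (k ^ 2 / 4) * hcq
      have h13 : (c - 3) * (c - 7) = 1 := by linear_combination hcq
      rw [h10]
      nlinarith [mul_nonneg (show 0 ≤ c - 3 by linarith) (h12 ▸ h11)]
    have h10 := two_mul_logb_le hc1 hu0 (mul_pos hδ0 hv0) hk0 h9
    linarith

lemma Phi2Ok.bound (hg : Phi2Ok EPinf theta1 g) (hc : 7 < c) (hcq : c ^ 2 = 10 * c - 20)
    (hδ : c * δ = c - 3) (A : JoinTree ℤ) (hA : Over EPinf A) : Bound g c δ A := by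
  induction hn : sizeOf A using Nat.strong_induction_on generalizing A with
  | _ n ih =>
    subst hn
    intro S i j hK
    have ih' : ∀ E : JoinTree ℤ, sizeOf E < sizeOf A → Over EPinf E → Bound g c δ E :=
      fun E hE hEA => ih _ hE E hEA rfl
    by_cases hS : i ∈ S ∨ j ∈ S
    · exact hg.bound_of_not_closed hc hδ hA ih' hK hS
    by_cases hij : j = i + 1
    · exact hg.bound_of_length_one hc hδ hA hij
    rw [not_or] at hS
    by_contra hlt
    rw [not_le, weight, if_neg hS.1, if_neg hS.2, one_mul] at hlt
    refine hg.false_of_initial_segment hc hcq hδ hA ih' hK hS.1 hS.2 hij hlt A (Desc.refl A) j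
      le_rfl hK (fun m h1 h2 => by omega) ?_
    have hk : (0 : ℝ) < ((j - i : ℤ) : ℝ) := by exact_mod_cast sub_pos.mpr hK.1
    nlinarith

end LowerBound

lemma delta_elimS_union_le {F : Finset (Sym2 ℤ)} (hF : (F : Set (Sym2 ℤ)) ⊆ EPinf)
    {S T : Set ℤ} {i j : ℤ} (h : ∀ l ∈ Set.Icc i j, l ∈ S ∪ T ∨ l + 1 ∈ S ∪ T) :
    Delta theta1 (elimS F (S ∪ T)) ≤ closedIn F S (Set.Icc i j)ᶜ := by
  rw [delta_elimS hF]
  refine Nat.cast_le.mpr (Set.ncard_le_ncard ?_ ((finite_starts F S).inter_of_left _))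
  rintro l ⟨r, hlr, hp, hS, hl, hr⟩
  refine ⟨⟨r, hlr, hp, fun m h1 h2 h3 => hS m h1 h2 (Or.inl h3), hl, hr⟩, fun hlK => ?_⟩
  rcases h l hlK with h | h
  · exact hS l le_rfl hlr.le h
  · exact hS (l + 1) (by omega) (by omega) h

/-- With `c = √5 + 5`, `δ = (c−3)/c` and `ε = 1/2`: for every
join-tree `A` over `P_∞`, every finite `S ⊆ ℤ`, and every component `K` of
`Gr(A)|S` of length `k`: if `K` is open then `Φ(A|S) ≥ log_c(εδk) + Δ(A|S ∪ V(K))`;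
if `K` is half-open then `Φ(A|S) ≥ log_c(δk) + Δ(A|S ∪ V(K))`; and if `K` is
closed then `Φ(A|S) ≥ log_c(k) + Δ(A|S ∪ V(K))`. -/
theorem stmt15 (A : JoinTree ℤ) (hover : Over EPinf A) (S : Set ℤ) (hS : S.Finite)
    (c δ ε : ℝ) (hc : c = Real.sqrt 5 + 5) (hδ : δ = (c - 3) / c) (hε : ε = 1 / 2) :
    (∀ i j : ℤ, OpenComp A.graph S i j →
      Real.logb c (ε * δ * ((j - i : ℤ) : ℝ))
          + Delta theta1 (elimS A.graph (S ∪ Set.Ioo (i : ℤ) j))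
        ≤ Phi2 EPinf theta1 A S) ∧
    (∀ i j : ℤ, HOLComp A.graph S i j →
      Real.logb c (δ * ((j - i : ℤ) : ℝ))
          + Delta theta1 (elimS A.graph (S ∪ Set.Ioc (i : ℤ) j))
        ≤ Phi2 EPinf theta1 A S) ∧
    (∀ i j : ℤ, HORComp A.graph S i j →
      Real.logb c (δ * ((j - i : ℤ) : ℝ))
          + Delta theta1 (elimS A.graph (S ∪ Set.Ioc (i : ℤ) j))
        ≤ Phi2 EPinf theta1 A S) ∧
    (∀ i j : ℤ, ClosedComp A.graph S i j →
      Real.logb c (((j - i : ℤ) : ℝ))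
          + Delta theta1 (elimS A.graph (S ∪ Set.Icc (i : ℤ) j))
        ≤ Phi2 EPinf theta1 A S) := by
  subst hε
  have h5 : (2 : ℝ) < Real.sqrt 5 := by
    rw [Real.lt_sqrt (by norm_num)]
    norm_num
  have hsq : Real.sqrt 5 ^ 2 = 5 := Real.sq_sqrt (by norm_num)
  have hc7 : 7 < c := by linarith
  have hcq : c ^ 2 = 10 * c - 20 := by
    rw [hc]
    linear_combination hsq
  have hcδ : c * δ = c - 3 := by
    rw [hδ]
    field_simp
  have key : ∀ (i j : ℤ) (T : Set ℤ), Comp A.graph S i j →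
      (∀ l ∈ Set.Icc i j, l ∈ S ∪ T ∨ l + 1 ∈ S ∪ T) →
      Real.logb c (weight δ S i j * ((j - i : ℤ) : ℝ)) + Delta theta1 (elimS A.graph (S ∪ T)) ≤
        Phi2 EPinf theta1 A S := fun i j T hK hT => le_phi2 fun g hg =>
    (add_le_add_right (delta_elimS_union_le hover hT) _).trans
      (hg.bound hc7 hcq hcδ A hover S i j hK)
  refine ⟨fun i j h => ?_, fun i j h => ?_, fun i j h => ?_, fun i j h => ?_⟩
  · obtain ⟨hij, hp, hm⟩ := h
    have hi : i ∈ S := (hm i le_rfl hij.le).mpr (Or.inl rfl)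
    have hj : j ∈ S := (hm j hij.le le_rfl).mpr (Or.inr rfl)
    have := key i j (Set.Ioo i j) ⟨hij, hp, fun m h1 h2 h3 => by
      have := (hm m h1.le h2.le).mp h3
      omega, Or.inl hi, Or.inl hj⟩ fun l hl => Or.inl (by
        rcases eq_or_lt_of_le hl.1 with rfl | h1
        · exact Or.inl hi
        rcases eq_or_lt_of_le hl.2 with rfl | h2
        · exact Or.inl hj
        · exact Or.inr ⟨h1, h2⟩)
    rwa [weight, if_pos hi, if_pos hj, div_eq_inv_mul, ← one_div] at this
  · obtain ⟨hij, hp, hm, hj⟩ := h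
    have hi : i ∈ S := (hm i le_rfl hij.le).mpr rfl
    have hjS : j ∉ S := fun h => hij.ne' ((hm j hij.le le_rfl).mp h)
    have := key i j (Set.Ioc i j) ⟨hij, hp, fun m h1 h2 h3 => h1.ne' ((hm m h1.le h2.le).mp h3),
      Or.inl hi, Or.inr hj⟩ fun l hl => Or.inl (by
        rcases eq_or_lt_of_le hl.1 with rfl | h1
        · exact Or.inl hi
        · exact Or.inr ⟨h1, hl.2⟩)
    rwa [weight, if_pos hi, if_neg hjS] at this
  · obtain ⟨hij, hp, hm, hi⟩ := h
    have hj : j ∈ S := (hm j hij.le le_rfl).mpr rfl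
    have hiS : i ∉ S := fun h => hij.ne ((hm i le_rfl hij.le).mp h)
    have := key i j (Set.Ioc i j) ⟨hij, hp, fun m h1 h2 h3 => h2.ne ((hm m h1.le h2.le).mp h3),
      Or.inr ((edge_sub_one _ _).not.mp hi), Or.inl hj⟩ fun l hl => by
        rcases eq_or_lt_of_le hl.1 with rfl | h1
        · exact Or.inr (Or.inr ⟨by omega, by omega⟩)
        · exact Or.inl (Or.inr ⟨h1, hl.2⟩)
    rwa [weight, if_neg hiS, if_pos hj] at this
  · obtain ⟨hij, hp, hm, hi, hj⟩ := h
    have := key i j (Set.Icc i j) ⟨hij, hp, fun m h1 h2 => hm m h1.le h2.le,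
      Or.inr ((edge_sub_one _ _).not.mp hi), Or.inr hj⟩ fun l hl => Or.inl (Or.inr hl)
    rwa [weight, if_neg (hm i le_rfl hij.le), if_neg (hm j hij.le le_rfl), one_mul] at this

end Paper

end
end
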